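/- (Comparison principle.) Let T > 0, let φ : ℝ → ℝ be continuous and nondecreasing, let μ be a Lévy measure on ℝ^N \ {0}, and let u₀, û₀ ∈ L^∞(ℝ^N) ∩ L¹(ℝ^N). Let u and û be distributional solutions in L^∞(Q_T) ∩ L¹(Q_T) ∩ C([0,T]; L¹_loc(ℝ^N)) of ∂_t v − L^μ[φ(v)] = 0 in Q_T with initial data u₀ and û₀ respectively. If u₀ ≤ û₀ a.e. in ℝ^N, then u ≤ û a.e. in Q_T. -/

import Mathlib

open MeasureTheory Set Filter

noncomputable section

/-- Euclidean space `ℝ^N`. -/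
abbrev Euc (N : ℕ) := EuclideanSpace ℝ (Fin N)

variable {N : ℕ}

/-- `μ` is a (symmetric) Lévy measure on `ℝ^N ∖ {0}` : it is a nonnegative measure giving no
mass to `{0}`, symmetric (`μ(−B) = μ(B)`), and `∫ min(|z|²,1) dμ(z) < ∞`. -/
def IsLevyMeasure (μ : Measure (Euc N)) : Prop :=
  μ {0} = 0 ∧ μ.map (fun z => -z) = μ ∧
    ∫⁻ z, ENNReal.ofReal (min (‖z‖ ^ 2) 1) ∂μ ≠ ⊤

/-- The nonlocal operator
`L^μ[ψ](x) = ∫ (ψ(x+z) − ψ(x) − z·Dψ(x) 1_{|z|≤1}) dμ(z)`. -/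
def Lop (μ : Measure (Euc N)) (ψ : Euc N → ℝ) (x : Euc N) : ℝ :=
  ∫ z, (ψ (x + z) - ψ x - (if ‖z‖ ≤ 1 then fderiv ℝ ψ x z else 0)) ∂μ

/-- `ψ ∈ C_c^∞(ℝ^N)`. -/
def IsTestFn (ψ : Euc N → ℝ) : Prop :=
  ContDiff ℝ (⊤ : ℕ∞) ψ ∧ HasCompactSupport ψ

/-- `ψ ∈ C_c^∞(ℝ^N × [0,T))` : smooth, compactly supported, and the support stays away
from `t = T` (but may touch `t = 0`). -/
def IsSTTestFn (T : ℝ) (ψ : Euc N → ℝ → ℝ) : Prop :=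
  ContDiff ℝ (⊤ : ℕ∞) (Function.uncurry ψ) ∧ HasCompactSupport (Function.uncurry ψ) ∧
    tsupport (Function.uncurry ψ) ⊆ {p : Euc N × ℝ | p.2 < T}

/-- `ψ ∈ C_c^∞(Q_T)` : smooth, compactly supported inside the open cylinder
`ℝ^N × (0,T)`. -/
def IsIntTestFn (T : ℝ) (ψ : Euc N → ℝ → ℝ) : Prop :=
  ContDiff ℝ (⊤ : ℕ∞) (Function.uncurry ψ) ∧ HasCompactSupport (Function.uncurry ψ) ∧
    tsupport (Function.uncurry ψ) ⊆ {p : Euc N × ℝ | 0 < p.2 ∧ p.2 < T}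

/-- The natural measure on the cylinder `Q_T = ℝ^N × (0,T)`. -/
def QTvol (N : ℕ) (T : ℝ) : Measure (Euc N × ℝ) :=
  (volume : Measure (Euc N)).prod ((volume : Measure ℝ).restrict (Ioo 0 T))

/-- `u ∈ L^∞(Q_T)`. -/
def MemLinfQT (T : ℝ) (u : Euc N → ℝ → ℝ) : Prop :=
  AEStronglyMeasurable (fun p : Euc N × ℝ => u p.1 p.2) (QTvol N T) ∧
    ∃ C : ℝ, ∀ᵐ p ∂(QTvol N T), |u p.1 p.2| ≤ C

/-- `u ∈ L¹(Q_T)`. -/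
def MemL1QT (T : ℝ) (u : Euc N → ℝ → ℝ) : Prop :=
  Integrable (fun p : Euc N × ℝ => u p.1 p.2) (QTvol N T)

/-- `u ∈ C([0,T]; L¹_loc(ℝ^N))` : for every compact `K`, `t ↦ u(·,t)` is continuous
from `[0,T]` into `L¹(K)`. -/
def MemCL1loc (T : ℝ) (u : Euc N → ℝ → ℝ) : Prop :=
  ∀ K : Set (Euc N), IsCompact K →
    (∀ t ∈ Icc (0 : ℝ) T, IntegrableOn (fun x => u x t) K) ∧
    ∀ t ∈ Icc (0 : ℝ) T,
      Tendsto (fun s => ∫ x in K, |u x s - u x t|) (nhdsWithin t (Icc 0 T)) (nhds 0)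

/-- `u` is a distributional solution of `∂_t u − A[φ(u)] = 0` in `Q_T` with initial
datum `u0` : for all `ψ ∈ C_c^∞(ℝ^N × [0,T))`,
`∫₀^T ∫ (u ∂_t ψ + φ(u) A[ψ(·,t)]) dx dt + ∫ u0(x) ψ(x,0) dx = 0`. -/
def IsDistSolOp (T : ℝ) (A : (Euc N → ℝ) → Euc N → ℝ) (φ : ℝ → ℝ)
    (u0 : Euc N → ℝ) (u : Euc N → ℝ → ℝ) : Prop :=
  ∀ ψ : Euc N → ℝ → ℝ, IsSTTestFn T ψ →
    (∫ t in Ioo (0 : ℝ) T, ∫ x,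
        (u x t * deriv (ψ x) t + φ (u x t) * A (fun y => ψ y t) x))
      + ∫ x, u0 x * ψ x 0 = 0

/-- `u0 ∈ L^∞(ℝ^N)`. -/
def MemLinfRn (u0 : Euc N → ℝ) : Prop :=
  AEStronglyMeasurable u0 (volume : Measure (Euc N)) ∧
    ∃ C : ℝ, ∀ᵐ x : Euc N ∂volume, |u0 x| ≤ C

end

noncomputable section

variable {N : ℕ}

/-- The jump operator of a (finite) measure. -/
def jump (ν : Measure (Euc N)) (f : Euc N → ℝ) (x : Euc N) : ℝ :=
  ∫ z, (f (x + z) - f x) ∂ν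

theorem IsTestFn.exists_taylor_bound {θ : Euc N → ℝ} (hθ : IsTestFn θ) :
    ∃ C : ℝ, 0 ≤ C ∧ ∀ x z, |θ (x + z) - θ x - fderiv ℝ θ x z| ≤ C * ‖z‖ ^ 2 := by
  have hd : ContDiff ℝ 1 (fderiv ℝ θ) := hθ.1.fderiv_right (by norm_cast)
  obtain ⟨K, hK⟩ := hd.lipschitzWith_of_hasCompactSupport (hθ.2.fderiv (𝕜 := ℝ)) one_ne_zero
  refine ⟨K, K.2, fun x z => ?_⟩
  have hdiff : Differentiable ℝ θ := hθ.1.differentiable (by simp)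
  have h := (convex_closedBall x ‖z‖).norm_image_sub_le_of_norm_hasFDerivWithin_le'
    (f := θ) (f' := fderiv ℝ θ) (φ := fderiv ℝ θ x) (C := K * ‖z‖) (x := x) (y := x + z)
    (fun y _ => (hdiff y).hasFDerivAt.hasFDerivWithinAt)
    (fun y hy => ?_) (by simp) (by simp)
  · rw [← Real.norm_eq_abs]
    simpa [pow_two, mul_assoc] using h
  · have h1 := hK.dist_le_mul y x
    rw [dist_eq_norm] at h1
    have h2 : dist y x ≤ ‖z‖ := hy
    exact h1.trans (by gcongr)

theorem IsTestFn.exists_bound {θ : Euc N → ℝ} (hθ : IsTestFn θ) :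
    ∃ C : ℝ, 0 ≤ C ∧ ∀ x, |θ x| ≤ C := by
  obtain ⟨C, hC⟩ := hθ.2.exists_bound_of_continuous hθ.1.continuous
  exact ⟨C, (norm_nonneg _).trans (hC 0), hC⟩

/-- The integrand of `Lop`. -/
def levyIntegrand (θ : Euc N → ℝ) (x z : Euc N) : ℝ :=
  θ (x + z) - θ x - (if ‖z‖ ≤ 1 then fderiv ℝ θ x z else 0)

theorem IsTestFn.exists_levyIntegrand_bound {θ : Euc N → ℝ} (hθ : IsTestFn θ) :
    ∃ C : ℝ, 0 ≤ C ∧ ∀ x z, |levyIntegrand θ x z| ≤ C * min (‖z‖ ^ 2) 1 := by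
  obtain ⟨C, hC0, hC⟩ := hθ.exists_taylor_bound
  obtain ⟨B, hB0, hB⟩ := hθ.exists_bound
  refine ⟨C + 2 * B, by positivity, fun x z => ?_⟩
  unfold levyIntegrand
  split_ifs with h
  · have : ‖z‖ ^ 2 ≤ 1 := by nlinarith [norm_nonneg z]
    rw [min_eq_left this]
    nlinarith [hC x z, sq_nonneg ‖z‖]
  · have : 1 ≤ ‖z‖ ^ 2 := by nlinarith [norm_nonneg z]
    rw [min_eq_right this, sub_zero]
    have := abs_sub (θ (x + z)) (θ x)
    linarith [hB x, hB (x + z)]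

theorem IsTestFn.exists_levyIntegrand_support {θ : Euc N → ℝ} (hθ : IsTestFn θ) :
    ∃ R : ℝ, ∀ x z, ‖z‖ ≤ 1 → x ∉ Metric.closedBall (0 : Euc N) R →
      levyIntegrand θ x z = 0 := by
  obtain ⟨R, hR⟩ := hθ.2.isCompact.isBounded.subset_closedBall (0 : Euc N)
  refine ⟨R + 1, fun x z hz hx => ?_⟩
  have hx0 : R + 1 < ‖x‖ := by simpa using hx
  have h1 : x ∉ tsupport θ := fun h => by
    have : ‖x‖ ≤ R := by simpa using hR h
    linarith
  have h2 : x + z ∉ tsupport θ := fun h => by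
    have : ‖x + z‖ ≤ R := by simpa using hR h
    have := norm_sub_le (x + z) z
    simp only [add_sub_cancel_right] at this
    linarith
  have h3 : fderiv ℝ θ x = 0 := by
    apply image_eq_zero_of_notMem_tsupport
    exact fun h => h1 (tsupport_fderiv_subset ℝ h)
  simp [levyIntegrand, image_eq_zero_of_notMem_tsupport h1,
    image_eq_zero_of_notMem_tsupport h2, h3]

theorem IsTestFn.measurable_levyIntegrand {θ : Euc N → ℝ} (hθ : IsTestFn θ) (x : Euc N) :
    Measurable (levyIntegrand θ x) := by
  have hc := hθ.1.continuous
  unfold levyIntegrand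
  refine Measurable.sub (by fun_prop) (Measurable.ite ?_ (by fun_prop) measurable_const)
  exact measurableSet_le measurable_norm measurable_const

theorem IsLevyMeasure.integrable_min {μ : Measure (Euc N)} (hμ : IsLevyMeasure μ) :
    Integrable (fun z => min (‖z‖ ^ 2) 1) μ := by
  refine ⟨by fun_prop, ?_⟩
  rw [hasFiniteIntegral_iff_ofReal (Eventually.of_forall fun z => by positivity)]
  exact hμ.2.2.lt_top

theorem IsTestFn.integrable_levyIntegrand {θ : Euc N → ℝ} (hθ : IsTestFn θ)
    {μ : Measure (Euc N)} (hμ : IsLevyMeasure μ) (x : Euc N) :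
    Integrable (levyIntegrand θ x) μ := by
  obtain ⟨C, -, hC⟩ := hθ.exists_levyIntegrand_bound
  exact (hμ.integrable_min.const_mul C).mono' (hθ.measurable_levyIntegrand x).aestronglyMeasurable
    (Eventually.of_forall (hC x))

/-- Truncation of a measure to jumps of size larger than `r`. -/
def bigJumps (μ : Measure (Euc N)) (r : ℝ) : Measure (Euc N) := μ.restrict {z | r < ‖z‖}

theorem IsLevyMeasure.isFiniteMeasure_bigJumps {μ : Measure (Euc N)} (hμ : IsLevyMeasure μ)
    {r : ℝ} (hr : 0 < r) : IsFiniteMeasure (bigJumps μ r) := by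
  refine ⟨?_⟩
  rw [bigJumps, Measure.restrict_apply_univ]
  have h := hμ.integrable_min.measure_ge_lt_top (ε := min (r ^ 2) 1) (by positivity)
  refine (measure_mono fun z hz => ?_).trans_lt h
  have : r < ‖z‖ := hz
  have h2 : r ^ 2 ≤ ‖z‖ ^ 2 := by gcongr
  exact min_le_min_right _ h2

theorem IsLevyMeasure.isNegInvariant_bigJumps {μ : Measure (Euc N)} (hμ : IsLevyMeasure μ)
    (r : ℝ) : (bigJumps μ r).IsNegInvariant := by
  refine ⟨?_⟩
  have h := (MeasurableEquiv.neg (Euc N)).measurableEmbedding.restrict_map μ {z | r < ‖z‖}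
  have h2 : μ.map (MeasurableEquiv.neg (Euc N)) = μ := hμ.2.1
  rw [h2] at h
  have h3 : (MeasurableEquiv.neg (Euc N)) ⁻¹' {z | r < ‖z‖} = {z | r < ‖z‖} := by
    ext z; simp
  rw [h3] at h
  exact h.symm

theorem integral_eq_zero_of_odd {ν : Measure (Euc N)} [ν.IsNegInvariant] {f : Euc N → ℝ}
    (hf : ∀ z, f (-z) = -f z) : ∫ z, f z ∂ν = 0 := by
  have h := integral_neg_eq_self f ν
  simp only [hf, integral_neg] at h
  linarith

theorem Lop_sub_jump {θ : Euc N → ℝ} (hθ : IsTestFn θ) {μ : Measure (Euc N)}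
    (hμ : IsLevyMeasure μ) {r : ℝ} (hr : 0 < r) (x : Euc N) :
    Lop μ θ x - jump (bigJumps μ r) θ x = ∫ z in {z | ‖z‖ ≤ r}, levyIntegrand θ x z ∂μ := by
  have := hμ.isFiniteMeasure_bigJumps hr
  have := hμ.isNegInvariant_bigJumps r
  have hS : MeasurableSet {z : Euc N | r < ‖z‖} := measurableSet_lt measurable_const measurable_norm
  have hcompl : {z : Euc N | r < ‖z‖}ᶜ = {z | ‖z‖ ≤ r} := by ext z; simp
  have hintg := hθ.integrable_levyIntegrand hμ x
  have h1 : Lop μ θ x = ∫ z in {z | r < ‖z‖}, levyIntegrand θ x z ∂μ +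
      ∫ z in {z | ‖z‖ ≤ r}, levyIntegrand θ x z ∂μ := by
    rw [← hcompl, integral_add_compl hS hintg]; rfl
  obtain ⟨B, hB0, hB⟩ := hθ.exists_bound
  have hc := hθ.1.continuous
  have hi1 : Integrable (fun z => θ (x + z) - θ x) (bigJumps μ r) := by
    refine Integrable.of_bound (by fun_prop) (2 * B) (Eventually.of_forall fun z => ?_)
    have := abs_sub (θ (x + z)) (θ x)
    rw [Real.norm_eq_abs]
    linarith [hB x, hB (x + z)]
  have hi2 : Integrable (levyIntegrand θ x) (bigJumps μ r) := hintg.restrict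
  have h2 : ∫ z, levyIntegrand θ x z ∂(bigJumps μ r) = jump (bigJumps μ r) θ x := by
    rw [← sub_eq_zero, jump, ← integral_sub hi2 hi1]
    apply integral_eq_zero_of_odd
    intro z
    simp only [levyIntegrand, norm_neg, map_neg]
    split_ifs <;> ring
  rw [h1, ← h2, bigJumps]; ring

theorem IsLevyMeasure.tendsto_smallJumps {μ : Measure (Euc N)} (hμ : IsLevyMeasure μ) :
    Tendsto (fun n : ℕ => ∫ z in {z | ‖z‖ ≤ 1 / ((n : ℝ) + 1)}, min (‖z‖ ^ 2) 1 ∂μ)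
      atTop (nhds 0) := by
  have hanti : Antitone fun n : ℕ => {z : Euc N | ‖z‖ ≤ 1 / ((n : ℝ) + 1)} := by
    intro n m hnm z hz
    exact le_trans (b := 1 / ((m : ℝ) + 1)) hz (by gcongr)
  have h := tendsto_setIntegral_of_antitone (μ := μ) (f := fun z : Euc N => min (‖z‖ ^ 2) 1)
    (fun n : ℕ => measurableSet_le measurable_norm measurable_const) hanti
    ⟨0, hμ.integrable_min.integrableOn⟩
  convert h using 2
  symm
  apply setIntegral_eq_zero_of_forall_eq_zero
  intro z hz
  have hz0 : ‖z‖ ≤ 0 := by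
    refine ge_of_tendsto' tendsto_one_div_add_atTop_nhds_zero_nat (fun n => ?_)
    exact mem_iInter.1 hz n
  have : ‖z‖ = 0 := le_antisymm hz0 (norm_nonneg _)
  simp [this]

theorem IsTestFn.integrable {θ : Euc N → ℝ} (hθ : IsTestFn θ) : Integrable θ :=
  hθ.1.continuous.integrable_of_hasCompactSupport hθ.2

theorem IsTestFn.exists_Lop_sub_jump_le {θ : Euc N → ℝ} (hθ : IsTestFn θ) {μ : Measure (Euc N)}
    (hμ : IsLevyMeasure μ) : ∃ C R : ℝ, 0 ≤ C ∧ ∀ r, 0 < r → r ≤ 1 → ∀ x,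
      |Lop μ θ x - jump (bigJumps μ r) θ x| ≤
        (Metric.closedBall (0 : Euc N) R).indicator
          (fun _ => C * ∫ z in {z | ‖z‖ ≤ r}, min (‖z‖ ^ 2) 1 ∂μ) x := by
  obtain ⟨C, hC0, hC⟩ := hθ.exists_levyIntegrand_bound
  obtain ⟨R, hR⟩ := hθ.exists_levyIntegrand_support
  refine ⟨C, R, hC0, fun r hr hr1 x => ?_⟩
  have hS : MeasurableSet {z : Euc N | ‖z‖ ≤ r} := measurableSet_le measurable_norm measurable_const
  rw [Lop_sub_jump hθ hμ hr]
  by_cases hx : x ∈ Metric.closedBall (0 : Euc N) R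
  · rw [indicator_of_mem hx, ← integral_const_mul, ← Real.norm_eq_abs]
    exact norm_integral_le_of_norm_le (hμ.integrable_min.const_mul C).restrict
      (Eventually.of_forall (hC x))
  · rw [indicator_of_notMem hx, setIntegral_eq_zero_of_forall_eq_zero, abs_zero]
    intro z hz
    exact hR x z (le_trans (b := r) hz hr1) hx

theorem jump_eq {ν : Measure (Euc N)} [IsFiniteMeasure ν] {f : Euc N → ℝ} (hf : Measurable f)
    {B : ℝ} (hB : ∀ x, |f x| ≤ B) (x : Euc N) :
    jump ν f x = ∫ z, f (x + z) ∂ν - ν.real univ * f x := by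
  have hi : Integrable (fun z => f (x + z)) ν :=
    Integrable.of_bound (Measurable.aestronglyMeasurable (by fun_prop)) B (Eventually.of_forall fun z => hB _)
  rw [jump, integral_sub hi (integrable_const _)]
  simp

theorem measurable_jump {ν : Measure (Euc N)} [IsFiniteMeasure ν] {f : Euc N → ℝ}
    (hf : Measurable f) : Measurable (jump ν f) := by
  have h : StronglyMeasurable (fun p : Euc N × Euc N => f (p.1 + p.2) - f p.1) :=
    Measurable.stronglyMeasurable (by fun_prop)
  exact h.integral_prod_right.measurable

theorem integrable_shift_prod {ν : Measure (Euc N)} [IsFiniteMeasure ν] {f : Euc N → ℝ}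
    (hf : Measurable f) (hfi : Integrable f) :
    Integrable (fun p : Euc N × Euc N => f (p.1 + p.2)) ((volume : Measure (Euc N)).prod ν) := by
  rw [integrable_prod_iff' (Measurable.aestronglyMeasurable (by fun_prop))]
  refine ⟨Eventually.of_forall fun z => hfi.comp_add_right z, ?_⟩
  simp only [integral_add_right_eq_self (fun x => ‖f x‖)]
  exact integrable_const _

/-- Bounded measurable integrable functions. -/
structure IsNice (f : Euc N → ℝ) : Prop where
  measurable : Measurable f
  bounded : ∃ C : ℝ, ∀ x, |f x| ≤ C
  integrable : Integrable f

theorem IsTestFn.isNice {θ : Euc N → ℝ} (hθ : IsTestFn θ) : IsNice θ :=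
  ⟨hθ.1.continuous.measurable, let ⟨C, _, hC⟩ := hθ.exists_bound; ⟨C, hC⟩, hθ.integrable⟩

theorem IsNice.jump {ν : Measure (Euc N)} [IsFiniteMeasure ν] {f : Euc N → ℝ} (hf : IsNice f) :
    IsNice (jump ν f) := by
  obtain ⟨B, hB⟩ := hf.bounded
  refine ⟨measurable_jump hf.measurable, ⟨2 * B * ν.real univ, fun x => ?_⟩, ?_⟩
  · rw [← Real.norm_eq_abs]
    refine norm_integral_le_of_norm_le_const (μ := ν) (Eventually.of_forall fun z => ?_)
    have := abs_sub (f (x + z)) (f x)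
    rw [Real.norm_eq_abs]
    linarith [hB x, hB (x + z)]
  · have h1 := (integrable_shift_prod (ν := ν) hf.measurable hf.integrable).integral_prod_left
    have h2 := h1.sub (hf.integrable.const_mul (ν.real univ))
    refine h2.congr (Eventually.of_forall fun x => ?_)
    exact (jump_eq hf.measurable hB x).symm

/-- A Lévy operator is approximated, in `L¹` on every test function, by jump operators of finite
symmetric measures. -/
theorem IsLevyMeasure.exists_approx {μ : Measure (Euc N)} (hμ : IsLevyMeasure μ) :
    ∃ ν : ℕ → Measure (Euc N), (∀ n, IsFiniteMeasure (ν n)) ∧ (∀ n, (ν n).IsNegInvariant) ∧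
      ∀ θ : Euc N → ℝ, IsTestFn θ → Measurable (Lop μ θ) ∧ Integrable (Lop μ θ) ∧
        Tendsto (fun n => ∫ x, |Lop μ θ x - jump (ν n) θ x|) atTop (nhds 0) := by
  have hr : ∀ n : ℕ, (0 : ℝ) < 1 / ((n : ℝ) + 1) := fun n => by positivity
  have hr1 : ∀ n : ℕ, 1 / ((n : ℝ) + 1) ≤ 1 := fun n => by
    rw [div_le_one (by positivity)]; linarith [Nat.cast_nonneg (α := ℝ) n]
  have hfin : ∀ n : ℕ, IsFiniteMeasure (bigJumps μ (1 / ((n : ℝ) + 1))) :=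
    fun n => hμ.isFiniteMeasure_bigJumps (hr n)
  refine ⟨fun n => bigJumps μ (1 / ((n : ℝ) + 1)), hfin,
    fun n => hμ.isNegInvariant_bigJumps _, fun θ hθ => ?_⟩
  obtain ⟨C, R, hC0, hCR⟩ := hθ.exists_Lop_sub_jump_le hμ
  have hbd : ∀ n : ℕ, ∀ x, _ := fun n => hCR _ (hr n) (hr1 n)
  have hlim := hμ.tendsto_smallJumps.const_mul C
  rw [mul_zero] at hlim
  have hmeas : Measurable (Lop μ θ) := by
    refine measurable_of_tendsto_metrizable
      (f := fun n : ℕ => jump (bigJumps μ (1 / ((n : ℝ) + 1))) θ)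
      (fun n => measurable_jump hθ.isNice.measurable) ?_
    rw [tendsto_pi_nhds]
    intro x
    rw [tendsto_iff_dist_tendsto_zero]
    refine squeeze_zero (fun n => dist_nonneg) (fun n => ?_) hlim
    rw [dist_comm, Real.dist_eq]
    refine (hbd n x).trans (indicator_le_self' (fun _ _ => ?_) x)
    exact mul_nonneg hC0 (integral_nonneg fun z => by positivity)
  have hind : ∀ n : ℕ, Integrable ((Metric.closedBall (0 : Euc N) R).indicator
      (fun _ => C * ∫ z in {z | ‖z‖ ≤ 1 / ((n : ℝ) + 1)}, min (‖z‖ ^ 2) 1 ∂μ)) := fun n => by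
    rw [integrable_indicator_iff Metric.isClosed_closedBall.measurableSet]
    exact integrableOn_const (isCompact_closedBall _ _).measure_lt_top.ne
  have hdiff : ∀ n : ℕ, Integrable (fun x => Lop μ θ x -
      jump (bigJumps μ (1 / ((n : ℝ) + 1))) θ x) := fun n =>
    (hind n).mono' (hmeas.sub (measurable_jump hθ.isNice.measurable)).aestronglyMeasurable
      (Eventually.of_forall (hbd n))
  refine ⟨hmeas, ?_, ?_⟩
  · refine ((hdiff 0).add (hθ.isNice.jump
      (ν := bigJumps μ (1 / (((0 : ℕ) : ℝ) + 1)))).integrable).congr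
      (Eventually.of_forall fun x => ?_)
    simp
  · have h0 := hlim.const_mul ((volume : Measure (Euc N)).real (Metric.closedBall 0 R))
    rw [mul_zero] at h0
    refine squeeze_zero (fun n => integral_nonneg fun x => abs_nonneg _) (fun n => ?_) h0
    refine (integral_mono (hdiff n).abs (hind n) (hbd n)).trans (le_of_eq ?_)
    rw [integral_indicator Metric.isClosed_closedBall.measurableSet]
    simp

theorem IsNice.add {f g : Euc N → ℝ} (hf : IsNice f) (hg : IsNice g) :
    IsNice (fun x => f x + g x) := by
  obtain ⟨B, hB⟩ := hf.bounded
  obtain ⟨C, hC⟩ := hg.bounded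
  exact ⟨hf.measurable.add hg.measurable,
    ⟨B + C, fun x => (abs_add_le _ _).trans (add_le_add (hB x) (hC x))⟩,
    hf.integrable.add hg.integrable⟩

theorem IsNice.abs {f : Euc N → ℝ} (hf : IsNice f) : IsNice (fun x => |f x|) := by
  obtain ⟨B, hB⟩ := hf.bounded
  exact ⟨hf.measurable.abs, ⟨B, fun x => by rw [abs_abs]; exact hB x⟩, hf.integrable.abs⟩

theorem IsNice.bdd_mul {h f : Euc N → ℝ} (hf : IsNice f) (hh : Measurable h) {C : ℝ}
    (hC : ∀ x, |h x| ≤ C) : IsNice (fun x => h x * f x) := by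
  obtain ⟨B, hB⟩ := hf.bounded
  refine ⟨hh.mul hf.measurable, ⟨C * B, fun x => ?_⟩,
    hf.integrable.bdd_mul hh.aestronglyMeasurable (Eventually.of_forall hC)⟩
  rw [abs_mul]
  exact mul_le_mul (hC x) (hB x) (abs_nonneg _) ((abs_nonneg _).trans (hC x))

theorem IsNice.const_mul {f : Euc N → ℝ} (hf : IsNice f) (c : ℝ) :
    IsNice (fun x => c * f x) :=
  hf.bdd_mul measurable_const (fun _ => le_refl |c|)

theorem IsNice.mul {f g : Euc N → ℝ} (hf : IsNice f) (hg : IsNice g) :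
    IsNice (fun x => f x * g x) := by
  obtain ⟨C, hC⟩ := hf.bounded
  exact hg.bdd_mul hf.measurable hC

section FiniteJumps

variable {ν : Measure (Euc N)} [IsFiniteMeasure ν]

theorem integral_mul_jump {f h : Euc N → ℝ} (hf : IsNice f) (hh : Measurable h) {C : ℝ}
    (hC : ∀ x, |h x| ≤ C) :
    ∫ x, h x * jump ν f x =
      ∫ z, (∫ x, h x * f (x + z)) ∂ν - ν.real univ * ∫ x, h x * f x := by
  obtain ⟨B, hB⟩ := hf.bounded
  have hintg : Integrable (fun p : Euc N × Euc N => h p.1 * f (p.1 + p.2))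
      ((volume : Measure (Euc N)).prod ν) :=
    (integrable_shift_prod hf.measurable hf.integrable).bdd_mul
      (Measurable.aestronglyMeasurable (by fun_prop)) (Eventually.of_forall fun p => hC p.1)
  rw [← integral_integral_swap (f := fun x z => h x * f (x + z)) hintg, ← integral_const_mul,
    ← integral_sub hintg.integral_prod_left ((hf.bdd_mul hh hC).const_mul _).integrable]
  refine integral_congr_ae (Eventually.of_forall fun x => ?_)
  simp only [jump_eq hf.measurable hB, integral_const_mul]
  ring

theorem integral_jump_mul {f h : Euc N → ℝ} (hf : IsNice f) (hh : Measurable h) {C : ℝ}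
    (hC : ∀ x, |h x| ≤ C) :
    ∫ x, f x * jump ν h x =
      ∫ z, (∫ x, f x * h (x + z)) ∂ν - ν.real univ * ∫ x, f x * h x := by
  have hintg : Integrable (fun p : Euc N × Euc N => f p.1 * h (p.1 + p.2))
      ((volume : Measure (Euc N)).prod ν) :=
    hf.integrable.comp_fst ν |>.mul_bdd
      (Measurable.aestronglyMeasurable (by fun_prop)) (Eventually.of_forall fun p => hC _)
  have hfh : Integrable (fun x => f x * h x) := by
    simpa only [mul_comm] using (hf.bdd_mul hh hC).integrable
  rw [← integral_integral_swap (f := fun x z => f x * h (x + z)) hintg, ← integral_const_mul,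
    ← integral_sub hintg.integral_prod_left (hfh.const_mul _)]
  refine integral_congr_ae (Eventually.of_forall fun x => ?_)
  simp only [jump_eq hh hC, integral_const_mul]
  ring

theorem integral_mul_jump_comm [ν.IsNegInvariant] {f h : Euc N → ℝ} (hf : IsNice f)
    (hh : Measurable h) {C : ℝ} (hC : ∀ x, |h x| ≤ C) :
    ∫ x, h x * jump ν f x = ∫ x, f x * jump ν h x := by
  rw [integral_mul_jump hf hh hC, integral_jump_mul hf hh hC]
  congr 1
  · rw [← integral_neg_eq_self]
    refine integral_congr_ae (Eventually.of_forall fun z => ?_)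
    have h1 := integral_add_right_eq_self (μ := (volume : Measure (Euc N)))
      (fun x => f x * h (x + z)) (-z)
    simp only [neg_add_cancel_right] at h1
    refine Eq.trans ?_ h1
    simp only [mul_comm]
  · simp only [mul_comm]

theorem integral_jump_eq_zero [ν.IsNegInvariant] {f : Euc N → ℝ} (hf : IsNice f) :
    ∫ x, jump ν f x = 0 := by
  have h := integral_mul_jump_comm (ν := ν) hf (h := fun _ => 1) measurable_const (C := 1) (by simp)
  simpa [jump] using h

theorem abs_integral_mul_shift_le {f : Euc N → ℝ} (hf : IsNice f) (z : Euc N) :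
    |∫ x, f x * f (x + z)| ≤ ∫ x, f x * f x := by
  have hs : Integrable (fun x => f x * f x) := (hf.mul hf).integrable
  have hs2 := hs.comp_add_right z
  have h1 : ∫ x, (f x * f x + f (x + z) * f (x + z)) / 2 = ∫ x, f x * f x := by
    rw [integral_div, integral_add hs hs2, integral_add_right_eq_self (fun x => f x * f x)]
    ring
  rw [← h1, ← Real.norm_eq_abs]
  refine norm_integral_le_of_norm_le ((hs.add hs2).div_const 2) (Eventually.of_forall fun x => ?_)
  rw [Real.norm_eq_abs, abs_le]
  constructor <;> nlinarith [sq_nonneg (f x + f (x + z)), sq_nonneg (f x - f (x + z))]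

theorem abs_integral_integral_mul_shift_le {f : Euc N → ℝ} (hf : IsNice f) :
    |∫ z, (∫ x, f x * f (x + z)) ∂ν| ≤ ν.real univ * ∫ x, f x * f x := by
  rw [← Real.norm_eq_abs, mul_comm]
  exact norm_integral_le_of_norm_le_const
    (Eventually.of_forall fun z => abs_integral_mul_shift_le hf z)

theorem integral_mul_jump_self_nonpos {f : Euc N → ℝ} (hf : IsNice f) :
    ∫ x, f x * jump ν f x ≤ 0 := by
  obtain ⟨C, hC⟩ := hf.bounded
  rw [integral_mul_jump hf hf.measurable hC]
  linarith [(abs_le.1 (abs_integral_integral_mul_shift_le (ν := ν) hf)).2]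

theorem neg_integral_mul_jump_self_le {f : Euc N → ℝ} (hf : IsNice f) :
    -∫ x, f x * jump ν f x ≤ 2 * ν.real univ * ∫ x, f x * f x := by
  obtain ⟨C, hC⟩ := hf.bounded
  rw [integral_mul_jump hf hf.measurable hC]
  linarith [(abs_le.1 (abs_integral_integral_mul_shift_le (ν := ν) hf)).1]

theorem jump_add_smul {f g : Euc N → ℝ} (hf : IsNice f) (hg : IsNice g) (c : ℝ) (x : Euc N) :
    jump ν (fun x => f x + c * g x) x = jump ν f x + c * jump ν g x := by
  obtain ⟨B, hB⟩ := hf.bounded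
  obtain ⟨C, hC⟩ := hg.bounded
  have hfm := hf.measurable
  have hgm := hg.measurable
  have h1 : Integrable (fun z => f (x + z) - f x) ν :=
    (Integrable.of_bound (Measurable.aestronglyMeasurable (by fun_prop)) B
      (Eventually.of_forall fun z => hB _)).sub (integrable_const _)
  have h2 : Integrable (fun z => g (x + z) - g x) ν :=
    (Integrable.of_bound (Measurable.aestronglyMeasurable (by fun_prop)) C
      (Eventually.of_forall fun z => hC _)).sub (integrable_const _)
  simp only [jump]
  rw [← integral_const_mul, ← integral_add h1 (h2.const_mul c)]
  congr 1 with z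
  ring

/-- Explicit Euler scheme for `∂ψ = a L_ν ψ`. -/
def dualSeq (ν : Measure (Euc N)) (τ : ℝ) (a : ℕ → Euc N → ℝ) (θ : Euc N → ℝ) :
    ℕ → Euc N → ℝ
  | 0 => θ
  | j + 1 => fun x => dualSeq ν τ a θ j x + τ * (a j x * jump ν (dualSeq ν τ a θ j) x)

variable {τ A κ : ℝ} {a : ℕ → Euc N → ℝ} {θ : Euc N → ℝ}

theorem isNice_dualSeq (ham : ∀ j, Measurable (a j)) (haA : ∀ j x, |a j x| ≤ A)
    (hθ : IsNice θ) (j : ℕ) : IsNice (dualSeq ν τ a θ j) := by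
  induction j with
  | zero => exact hθ
  | succ j ih => exact ih.add ((ih.jump.bdd_mul (ham j) (haA j)).const_mul τ)

theorem dualSeq_nonneg (ham : ∀ j, Measurable (a j)) (ha0 : ∀ j x, 0 ≤ a j x)
    (haA : ∀ j x, a j x ≤ A) (hτ : 0 ≤ τ) (hcfl : τ * A * ν.real univ ≤ 1)
    (hθ : IsNice θ) (hθ0 : ∀ x, 0 ≤ θ x) (j : ℕ) (x : Euc N) : 0 ≤ dualSeq ν τ a θ j x := by
  induction j generalizing x with
  | zero => exact hθ0 x
  | succ j ih =>
    have hn : IsNice (dualSeq ν τ a θ j) :=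
      isNice_dualSeq ham (fun j x => by rw [abs_of_nonneg (ha0 j x)]; exact haA j x) hθ j
    obtain ⟨B, hB⟩ := hn.bounded
    simp only [dualSeq, jump_eq hn.measurable hB]
    have h1 : 0 ≤ ∫ z, dualSeq ν τ a θ j (x + z) ∂ν := integral_nonneg fun z => ih _
    have h2 : τ * a j x * ν.real univ ≤ 1 := by
      refine le_trans ?_ hcfl
      gcongr
      exact haA j x
    have h3 := mul_nonneg (mul_nonneg hτ (ha0 j x)) h1
    have h4 := mul_nonneg (ih x) (sub_nonneg.2 h2)
    linarith

theorem integral_abs_jump_dualSeq_le [ν.IsNegInvariant] (ham : ∀ j, Measurable (a j))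
    (ha0 : ∀ j x, 0 ≤ a j x) (haA : ∀ j x, a j x ≤ A) (hτ : 0 ≤ τ)
    (hcfl : τ * A * ν.real univ ≤ 1) (hθ : IsNice θ) (j : ℕ) :
    ∫ x, |jump ν (dualSeq ν τ a θ j) x| ≤ ∫ x, |jump ν θ x| := by
  have haA' : ∀ j x, |a j x| ≤ A := fun j x => by rw [abs_of_nonneg (ha0 j x)]; exact haA j x
  induction j with
  | zero => exact le_rfl
  | succ j ih =>
    refine le_trans ?_ ih
    have hn : IsNice (dualSeq ν τ a θ j) := isNice_dualSeq ham haA' hθ j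
    set q := jump ν (dualSeq ν τ a θ j) with hq
    have hqn : IsNice q := hn.jump
    have hpn : IsNice (fun x => a j x * q x) := hqn.bdd_mul (ham j) (haA' j)
    obtain ⟨B, hB⟩ := hpn.bounded
    have hstep : ∀ x, |jump ν (dualSeq ν τ a θ (j + 1)) x| ≤
        |q x| + τ * jump ν (fun x => |a j x * q x|) x := fun x => by
      simp only [dualSeq]
      rw [jump_add_smul hn hpn, ← hq, jump_eq hpn.measurable hB,
        jump_eq hpn.abs.measurable (fun x => by rw [abs_abs]; exact hB x)]
      have h1 : |∫ z, a j (x + z) * q (x + z) ∂ν| ≤ ∫ z, |a j (x + z) * q (x + z)| ∂ν :=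
        abs_integral_le_integral_abs
      have h2 : τ * a j x * ν.real univ ≤ 1 := by
        refine le_trans ?_ hcfl
        gcongr
        exact haA j x
      have h3 : q x + τ * (∫ z, a j (x + z) * q (x + z) ∂ν - ν.real univ * (a j x * q x)) =
        (1 - τ * a j x * ν.real univ) * q x + τ * ∫ z, a j (x + z) * q (x + z) ∂ν := by ring
      rw [h3]
      refine (abs_add_le _ _).trans ?_
      rw [abs_mul, abs_mul, abs_of_nonneg (sub_nonneg.2 h2), abs_of_nonneg hτ, abs_mul,
        abs_of_nonneg (ha0 j x)]
      have := mul_le_mul_of_nonneg_left h1 hτ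
      linarith
    refine (integral_mono (isNice_dualSeq ham haA' hθ (j + 1)).jump.integrable.abs
      (hqn.abs.add (hpn.abs.jump.const_mul τ)).integrable hstep).trans (le_of_eq ?_)
    rw [integral_add hqn.abs.integrable (hpn.abs.jump.const_mul τ).integrable, integral_const_mul,
      integral_jump_eq_zero hpn.abs]
    ring

theorem integral_dualSeq_le [ν.IsNegInvariant] (ham : ∀ j, Measurable (a j))
    (ha0 : ∀ j x, 0 ≤ a j x) (haA : ∀ j x, a j x ≤ A) (hA : 0 ≤ A) (hτ : 0 ≤ τ)
    (hcfl : τ * A * ν.real univ ≤ 1) (hθ : IsNice θ) (j : ℕ) :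
    ∫ x, dualSeq ν τ a θ j x ≤ (∫ x, θ x) + j * τ * A * ∫ x, |jump ν θ x| := by
  have haA' : ∀ j x, |a j x| ≤ A := fun j x => by rw [abs_of_nonneg (ha0 j x)]; exact haA j x
  induction j with
  | zero => simp [dualSeq]
  | succ j ih =>
    have hn : IsNice (dualSeq ν τ a θ j) := isNice_dualSeq ham haA' hθ j
    have hpn := hn.jump (ν := ν) |>.bdd_mul (ham j) (haA' j)
    have h1 : ∫ x, a j x * jump ν (dualSeq ν τ a θ j) x ≤ A * ∫ x, |jump ν θ x| := by
      refine le_trans ?_ (mul_le_mul_of_nonneg_left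
        (integral_abs_jump_dualSeq_le ham ha0 haA hτ hcfl hθ j) hA)
      rw [← integral_const_mul]
      refine integral_mono hpn.integrable (hn.jump.abs.const_mul A).integrable fun x => ?_
      refine (le_abs_self _).trans ?_
      simp only [abs_mul]
      gcongr
      exact haA' j x
    simp only [dualSeq]
    rw [integral_add hn.integrable (hpn.const_mul τ).integrable, integral_const_mul]
    have := mul_le_mul_of_nonneg_left h1 hτ
    push_cast
    linarith

theorem energy_dualSeq_le [ν.IsNegInvariant] (ham : ∀ j, Measurable (a j)) (hκ : 0 ≤ κ)
    (ha0 : ∀ j x, κ ≤ a j x) (haA : ∀ j x, a j x ≤ A) (hτ : 0 ≤ τ)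
    (hcfl : 2 * (τ * A * ν.real univ) ≤ 1) (hθ : IsNice θ) (n : ℕ) :
    τ * κ * ∑ j ∈ Finset.range n, ∫ x, jump ν (dualSeq ν τ a θ j) x ^ 2 ≤
      (-∫ x, θ x * jump ν θ x) -
        -∫ x, dualSeq ν τ a θ n x * jump ν (dualSeq ν τ a θ n) x := by
  have haA' : ∀ j x, |a j x| ≤ A := fun j x => by
    rw [abs_of_nonneg (hκ.trans (ha0 j x))]; exact haA j x
  induction n with
  | zero => simp [dualSeq]
  | succ j ih =>
    rw [Finset.sum_range_succ, mul_add]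
    have hn : IsNice (dualSeq ν τ a θ j) := isNice_dualSeq ham haA' hθ j
    set ψ := dualSeq ν τ a θ j with hψ
    have hqn : IsNice (jump ν ψ) := hn.jump
    set q := jump ν ψ with hq
    have hpn : IsNice (fun x => a j x * q x) := hqn.bdd_mul (ham j) (haA' j)
    set p := fun x => a j x * q x with hp
    obtain ⟨Bp, hBp⟩ := hpn.bounded
    obtain ⟨Bψ, hBψ⟩ := hn.bounded
    have hval : ∀ x, dualSeq ν τ a θ (j + 1) x * jump ν (dualSeq ν τ a θ (j + 1)) x =
        ψ x * q x + (τ * (p x * q x) + (τ * (ψ x * jump ν p x) +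
          τ ^ 2 * (p x * jump ν p x))) := fun x => by
      have : dualSeq ν τ a θ (j + 1) = fun x => ψ x + τ * p x := rfl
      rw [this, jump_add_smul hn hpn, ← hq]
      ring
    have hexp : ∫ x, dualSeq ν τ a θ (j + 1) x * jump ν (dualSeq ν τ a θ (j + 1)) x =
        (∫ x, ψ x * q x) + (τ * (∫ x, p x * q x) + (τ * (∫ x, ψ x * jump ν p x) +
          τ ^ 2 * ∫ x, p x * jump ν p x)) := by
      simp only [hval]
      have i1 := (hn.mul hqn).integrable
      have i2 := ((hpn.mul hqn).const_mul τ).integrable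
      have i3 := ((hn.mul (hpn.jump (ν := ν))).const_mul τ).integrable
      have i4 := ((hpn.mul (hpn.jump (ν := ν))).const_mul (τ ^ 2)).integrable
      have e1 := integral_add i1 (i2.add (i3.add i4))
      have e2 := integral_add i2 (i3.add i4)
      have e3 := integral_add i3 i4
      simp only [Pi.add_apply, integral_const_mul] at e1 e2 e3
      rw [e1, e2, e3]
    have hcomm : ∫ x, ψ x * jump ν p x = ∫ x, p x * q x :=
      integral_mul_jump_comm hpn hn.measurable hBψ
    have hneg := neg_integral_mul_jump_self_le (ν := ν) hpn
    have hpp : ∫ x, p x * p x ≤ A * ∫ x, p x * q x := by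
      rw [← integral_const_mul]
      refine integral_mono (hpn.mul hpn).integrable ((hpn.mul hqn).const_mul A).integrable
        fun x => ?_
      have h1 : p x * p x = a j x * (a j x * q x ^ 2) := by simp only [hp]; ring
      have h2 : A * (p x * q x) = A * (a j x * q x ^ 2) := by simp only [hp]; ring
      simp only [h1, h2]
      exact mul_le_mul_of_nonneg_right (haA j x)
        (mul_nonneg (hκ.trans (ha0 j x)) (sq_nonneg _))
    have hqq : κ * ∫ x, q x ^ 2 ≤ ∫ x, p x * q x := by
      have hq2 : Integrable (fun x => κ * q x ^ 2) := by
        simpa only [pow_two] using ((hqn.mul hqn).const_mul κ).integrable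
      rw [← integral_const_mul]
      refine integral_mono hq2 (hpn.mul hqn).integrable fun x => ?_
      have h1 : p x * q x = a j x * q x ^ 2 := by simp only [hp]; ring
      simp only [h1]
      exact mul_le_mul_of_nonneg_right (ha0 j x) (sq_nonneg _)
    have hpq0 : 0 ≤ ∫ x, p x * q x :=
      (mul_nonneg hκ (integral_nonneg fun x => sq_nonneg _)).trans hqq
    have hmass : 0 ≤ ν.real univ := measureReal_nonneg
    have k1 : τ ^ 2 * -∫ x, p x * jump ν p x ≤ τ * ∫ x, p x * q x := by
      have s1 := mul_le_mul_of_nonneg_left hneg (sq_nonneg τ)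
      have s2 := mul_le_mul_of_nonneg_left hpp
        (by positivity : 0 ≤ τ ^ 2 * (2 * ν.real univ))
      have s3 := mul_le_mul_of_nonneg_right hcfl (mul_nonneg hτ hpq0)
      linarith
    have k2 := mul_le_mul_of_nonneg_left hqq hτ
    rw [hexp, hcomm]
    linarith

end FiniteJumps

section Duality

variable {ν : Measure (Euc N)} [IsFiniteMeasure ν] [ν.IsNegInvariant]

theorem integrable_mul_prod_Ioc {G : Euc N → ℝ → ℝ} (hG : Measurable (Function.uncurry G)) {CG : ℝ}
    (hCG : ∀ x s, |G x s| ≤ CG) {ψ : Euc N → ℝ} (hψ : IsNice ψ) (s0 s1 : ℝ) :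
    Integrable (fun p : Euc N × ℝ => G p.1 p.2 * ψ p.1)
      ((volume : Measure (Euc N)).prod (volume.restrict (Ioc s0 s1))) :=
  (hψ.integrable.comp_fst _).bdd_mul (Measurable.aestronglyMeasurable hG)
    (Eventually.of_forall fun p => hCG p.1 p.2)

/-- One step of the discrete duality argument. -/
theorem duality_step {G h D : Euc N → ℝ → ℝ} {W0 W1 ψ a : Euc N → ℝ} {s0 s1 CG Ch CW A b ε σ : ℝ}
    (hs : s0 ≤ s1) (hG : Measurable (Function.uncurry G)) (hCG : ∀ x s, |G x s| ≤ CG)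
    (hh : Measurable (Function.uncurry h)) (hCh : ∀ x s, |h x s| ≤ Ch)
    (hGh : ∀ x s, |G x s - jump ν (fun y => h y s) x| ≤ ε)
    (hW0 : Measurable W0) (hCW : ∀ x, |W0 x| ≤ CW)
    (hW1 : ∀ x, W1 x = W0 x + ∫ s in Ioc s0 s1, G x s)
    (hψ : IsNice ψ) (hψ0 : ∀ x, 0 ≤ ψ x) (ha : Measurable a) (haA : ∀ x, |a x| ≤ A)
    (hσ : 0 < σ)
    (hdi : IntegrableOn (fun s => ∫ x, D x s ^ 2) (Ioc s0 s1))
    (hD : ∀ᵐ s ∂(volume.restrict (Ioc s0 s1)), Integrable (fun x => D x s ^ 2) ∧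
      ∀ᵐ x, |h x s - a x * W0 x| ≤ D x s + b) :
    (∫ x, W1 x * ψ x) - ∫ x, W0 x * (ψ x + (s1 - s0) * (a x * jump ν ψ x)) ≤
      (1 / (2 * σ)) * (∫ s in Ioc s0 s1, ∫ x, D x s ^ 2) +
        (s1 - s0) * ((σ / 2) * (∫ x, jump ν ψ x ^ 2) + b * (∫ x, |jump ν ψ x|) +
          ε * ∫ x, ψ x) := by
  have hprod := integrable_mul_prod_Ioc hG hCG hψ s0 s1
  have hqn : IsNice (jump ν ψ) := hψ.jump
  set q := jump ν ψ with hq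
  have hq2 : Integrable (fun x => q x ^ 2) := by
    simpa only [pow_two] using (hqn.mul hqn).integrable
  have haq : IsNice (fun x => W0 x * (a x * q x)) := (hqn.bdd_mul ha haA).bdd_mul hW0 hCW
  have hW0ψ : IsNice (fun x => W0 x * ψ x) := hψ.bdd_mul hW0 hCW
  have hvol : (volume.restrict (Ioc s0 s1)).real univ = s1 - s0 := by
    rw [measureReal_restrict_apply_univ, Real.volume_real_Ioc_of_le hs]
  have e1 : ∫ x, W1 x * ψ x =
      (∫ x, W0 x * ψ x) + ∫ s in Ioc s0 s1, ∫ x, G x s * ψ x := by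
    rw [← integral_integral_swap (f := fun x s => G x s * ψ x) hprod,
      ← integral_add hW0ψ.integrable hprod.integral_prod_left]
    refine integral_congr_ae (Eventually.of_forall fun x => ?_)
    simp only [hW1, integral_mul_const]
    ring
  have e2 : ∫ x, W0 x * (ψ x + (s1 - s0) * (a x * q x)) =
      (∫ x, W0 x * ψ x) + ∫ s in Ioc s0 s1, ∫ x, W0 x * (a x * q x) := by
    rw [integral_const, hvol, smul_eq_mul, ← integral_const_mul,
      ← integral_add hW0ψ.integrable (haq.const_mul _).integrable]
    congr 1 with x
    ring
  have i1 : Integrable (fun s => ∫ x, G x s * ψ x) (volume.restrict (Ioc s0 s1)) :=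
    hprod.integral_prod_right
  have e3 : (∫ x, W1 x * ψ x) - ∫ x, W0 x * (ψ x + (s1 - s0) * (a x * q x)) =
      ∫ s in Ioc s0 s1, ((∫ x, G x s * ψ x) - ∫ x, W0 x * (a x * q x)) := by
    rw [e1, e2, integral_sub i1 (integrable_const _)]
    ring
  have e4 : (1 / (2 * σ)) * (∫ s in Ioc s0 s1, ∫ x, D x s ^ 2) +
        (s1 - s0) * ((σ / 2) * (∫ x, q x ^ 2) + b * (∫ x, |q x|) + ε * ∫ x, ψ x) =
      ∫ s in Ioc s0 s1, ((1 / (2 * σ)) * (∫ x, D x s ^ 2) +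
        ((σ / 2) * (∫ x, q x ^ 2) + b * (∫ x, |q x|) + ε * ∫ x, ψ x)) := by
    rw [integral_add (hdi.const_mul _) (integrable_const _), integral_const, hvol,
      integral_const_mul, smul_eq_mul]
  rw [e3, e4]
  refine integral_mono_ae (i1.sub (integrable_const _))
    ((hdi.const_mul _).add (integrable_const _)) ?_
  filter_upwards [hD] with s ⟨hDs, hDx⟩
  have hhs : Measurable (fun y => h y s) := hh.comp measurable_prodMk_right
  have hGs : Measurable (fun y => G y s) := hG.comp measurable_prodMk_right
  have hjm : Measurable (jump ν (fun y => h y s)) := measurable_jump hhs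
  have hjb : ∀ x, |jump ν (fun y => h y s) x| ≤ CG + ε := fun x => by
    have h1 := hGh x s
    have h2 := hCG x s
    rw [abs_le] at h1 h2 ⊢
    constructor <;> linarith
  have b1 : ∫ x, G x s * ψ x ≤ (∫ x, h x s * q x) + ε * ∫ x, ψ x := by
    rw [integral_mul_jump_comm hψ hhs (fun x => hCh x s), ← integral_const_mul]
    have hn := hψ.bdd_mul hjm hjb
    have hn' : Integrable (fun x => ψ x * jump ν (fun y => h y s) x) := by
      simpa only [mul_comm] using hn.integrable
    rw [← integral_add hn' (hψ.const_mul ε).integrable]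
    refine integral_mono (hψ.bdd_mul hGs (fun x => hCG x s)).integrable
      (hn'.add (hψ.const_mul ε).integrable) fun x => ?_
    have h1 := (abs_le.1 (hGh x s)).2
    have := mul_le_mul_of_nonneg_right h1 (hψ0 x)
    linarith
  have hhq := hqn.bdd_mul hhs (fun x => hCh x s)
  have b2 : (∫ x, h x s * q x) - ∫ x, W0 x * (a x * q x) ≤
      (1 / (2 * σ)) * (∫ x, D x s ^ 2) + ((σ / 2) * (∫ x, q x ^ 2) + b * ∫ x, |q x|) := by
    have i2 : Integrable (fun x => σ / 2 * q x ^ 2 + b * |q x|) :=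
      (hq2.const_mul _).add (hqn.integrable.abs.const_mul _)
    rw [← integral_sub hhq.integrable haq.integrable, ← integral_const_mul, ← integral_const_mul,
      ← integral_const_mul, ← integral_add (hq2.const_mul _) (hqn.integrable.abs.const_mul _),
      ← integral_add (hDs.const_mul _) i2]
    refine integral_mono_ae (hhq.integrable.sub haq.integrable) ((hDs.const_mul _).add i2) ?_
    filter_upwards [hDx] with x hx
    have k1 : h x s * q x - W0 x * (a x * q x) ≤ (D x s + b) * |q x| := by
      have : h x s * q x - W0 x * (a x * q x) = (h x s - a x * W0 x) * q x := by ring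
      rw [this]
      refine (le_abs_self _).trans ?_
      rw [abs_mul]
      gcongr
    have k2 : D x s * |q x| ≤ 1 / (2 * σ) * D x s ^ 2 + σ / 2 * q x ^ 2 := by
      have h1 : 0 ≤ (D x s - σ * |q x|) ^ 2 / (2 * σ) := by positivity
      have h2 : (D x s - σ * |q x|) ^ 2 / (2 * σ) =
          1 / (2 * σ) * D x s ^ 2 + σ / 2 * |q x| ^ 2 - D x s * |q x| := by
        field_simp
        ring
      rw [sq_abs] at h2
      linarith
    linarith
  linarith

/-- The discrete duality estimate. -/
theorem duality_estimate {G h D : Euc N → ℝ → ℝ} {w₀ θ : Euc N → ℝ} {a : ℕ → Euc N → ℝ}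
    {t₁ CG Ch CW A κ b ε σ : ℝ} {K : ℕ}
    (ht₁ : 0 ≤ t₁) (hK : K ≠ 0)
    (hG : Measurable (Function.uncurry G)) (hCG : ∀ x s, |G x s| ≤ CG)
    (hh : Measurable (Function.uncurry h)) (hCh : ∀ x s, |h x s| ≤ Ch)
    (hGh : ∀ x s, |G x s - jump ν (fun y => h y s) x| ≤ ε)
    (hw₀ : Measurable w₀) (hCW : ∀ x, |w₀ x| ≤ CW) (hw₀n : ∀ x, w₀ x ≤ 0)
    (hθ : IsNice θ) (hθ0 : ∀ x, 0 ≤ θ x) (ham : ∀ j, Measurable (a j)) (hκ : 0 < κ)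
    (ha0 : ∀ j x, κ ≤ a j x) (haA : ∀ j x, a j x ≤ A)
    (hcfl : 2 * (t₁ / K * A * ν.real univ) ≤ 1) (hσ : 0 < σ) (hb : 0 ≤ b) (hε : 0 ≤ ε)
    (hdi : IntegrableOn (fun s => ∫ x, D x s ^ 2) (Ioc 0 t₁))
    (hDi : ∀ᵐ s ∂(volume.restrict (Ioc 0 t₁)), Integrable (fun x => D x s ^ 2))
    (hD : ∀ᵐ s ∂(volume.restrict (Ioc 0 t₁)), ∀ᵐ x, ∀ j : ℕ,
      s ∈ Ioc (t₁ - (j + 1 : ℕ) * (t₁ / K)) (t₁ - j * (t₁ / K)) → 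
      |h x s - a j x * (w₀ x + ∫ r in (0 : ℝ)..(t₁ - (j + 1 : ℕ) * (t₁ / K)), G x r)|
        ≤ D x s + b) :
    ∫ x, (w₀ x + ∫ r in (0 : ℝ)..t₁, G x r) * θ x ≤
      (1 / (2 * σ)) * (∫ s in Ioc 0 t₁, ∫ x, D x s ^ 2) +
        σ / (2 * κ) * (-∫ x, θ x * jump ν θ x) + t₁ * b * (∫ x, |jump ν θ x|) +
        t₁ * ε * ((∫ x, θ x) + t₁ * A * ∫ x, |jump ν θ x|) := by
  have hK0 : (0 : ℝ) < K := by positivity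
  set τ := t₁ / K with hτdef
  have hτ : 0 ≤ τ := by positivity
  have hKτ : K * τ = t₁ := by rw [hτdef]; field_simp
  have hA : 0 ≤ A := hκ.le.trans ((ha0 0 0).trans (haA 0 0))
  have ha00 : ∀ j x, 0 ≤ a j x := fun j x => hκ.le.trans (ha0 j x)
  have haA' : ∀ j x, |a j x| ≤ A := fun j x => by rw [abs_of_nonneg (ha00 j x)]; exact haA j x
  have hmass : 0 ≤ τ * A * ν.real univ := by positivity
  have hcfl1 : τ * A * ν.real univ ≤ 1 := by linarith
  have hJ : 0 ≤ ∫ x, |jump ν θ x| := integral_nonneg fun x => abs_nonneg _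
  have hGi : ∀ x r s, IntervalIntegrable (G x) volume r s := fun x r s => by
    have : Measurable (G x) := hG.comp measurable_prodMk_left
    rw [intervalIntegrable_iff]
    exact Measure.integrableOn_of_bounded (M := CG) (by simp) this.aestronglyMeasurable
      (Eventually.of_forall fun s => hCG x s)
  set W : ℝ → Euc N → ℝ := fun t x => w₀ x + ∫ r in (0 : ℝ)..t, G x r with hW
  have hWm : ∀ t, 0 ≤ t → Measurable (W t) := fun t ht => by
    have h1 : StronglyMeasurable (fun x => ∫ r in Ioc 0 t, G x r) :=
      hG.stronglyMeasurable.integral_prod_right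
    simp only [hW, intervalIntegral.integral_of_le ht]
    exact hw₀.add h1.measurable
  have hWb : ∀ t x, |W t x| ≤ CW + CG * |t| := fun t x => by
    refine (abs_add_le _ _).trans (add_le_add (hCW x) ?_)
    have := intervalIntegral.norm_integral_le_of_norm_le_const (a := 0) (b := t) (C := CG)
      (f := G x) (fun s _ => hCG x s)
    simpa using this
  set t : ℕ → ℝ := fun j => t₁ - j * τ with ht
  have htK : t K = 0 := by simp only [ht, hKτ, sub_self]
  have ht0 : t 0 = t₁ := by simp [ht]
  have htstep : ∀ j, t j - t (j + 1) = τ := fun j => by simp only [ht]; push_cast; ring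
  have htnn : ∀ j, j ≤ K → 0 ≤ t j := fun j hj => by
    have : (j : ℝ) * τ ≤ K * τ := by gcongr
    simp only [ht]; linarith
  have htle : ∀ j, t j ≤ t₁ := fun j => by
    have : 0 ≤ (j : ℝ) * τ := by positivity
    simp only [ht]; linarith
  set ψ := dualSeq ν τ a θ with hψ
  have hψn : ∀ j, IsNice (ψ j) := isNice_dualSeq ham haA' hθ
  have hψ0 : ∀ j x, 0 ≤ ψ j x := dualSeq_nonneg ham ha00 haA hτ hcfl1 hθ hθ0
  have hsub : ∀ j, j < K → Ioc (t (j + 1)) (t j) ⊆ Ioc 0 t₁ := fun j hj =>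
    Ioc_subset_Ioc (htnn _ hj) (htle _)
  have step : ∀ j ∈ Finset.range K, (∫ x, W (t j) x * ψ j x) - ∫ x, W (t (j + 1)) x * ψ (j + 1) x ≤
      (1 / (2 * σ)) * (∫ s in Ioc (t (j + 1)) (t j), ∫ x, D x s ^ 2) +
        τ * ((σ / 2) * (∫ x, jump ν (ψ j) x ^ 2) + b * (∫ x, |jump ν θ x|) +
          ε * ((∫ x, θ x) + t₁ * A * ∫ x, |jump ν θ x|)) := fun j hj => by
    have hj' : j < K := Finset.mem_range.1 hj
    have hle : t (j + 1) ≤ t j := by linarith [htstep j]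
    have h1 := duality_step (ν := ν) (G := G) (h := h) (D := D) (W0 := W (t (j + 1))) (W1 := W (t j))
      (ψ := ψ j) (a := a j) (b := b) (σ := σ) hle hG hCG hh hCh hGh
      (hWm _ (htnn _ hj')) (hWb _) (fun x => ?_) (hψn j) (hψ0 j) (ham j) (haA' j) hσ
      (hdi.mono_set (hsub j hj')) ?_
    · rw [htstep] at h1
      refine h1.trans ?_
      have k1 : ∫ x, |jump ν (ψ j) x| ≤ ∫ x, |jump ν θ x| :=
        integral_abs_jump_dualSeq_le ham ha00 haA hτ hcfl1 hθ j
      have k2 : ∫ x, ψ j x ≤ (∫ x, θ x) + t₁ * A * ∫ x, |jump ν θ x| := by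
        refine (integral_dualSeq_le ham ha00 haA hA hτ hcfl1 hθ j).trans ?_
        have : (j : ℝ) * τ ≤ t₁ := by
          rw [← hKτ]; gcongr
        gcongr
      gcongr
    · simp only [hW]
      rw [← intervalIntegral.integral_of_le hle, add_assoc,
        intervalIntegral.integral_add_adjacent_intervals (hGi _ _ _) (hGi _ _ _)]
    · have m := ae_mono (Measure.restrict_mono_set volume (hsub j hj'))
      filter_upwards [m hDi, m hD, ae_restrict_mem measurableSet_Ioc] with s k1 k2 k3
      refine ⟨k1, ?_⟩
      filter_upwards [k2] with x hx
      exact hx j k3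
  have hsum := Finset.sum_le_sum step
  rw [Finset.sum_range_sub' (fun j => ∫ x, W (t j) x * ψ j x), Finset.sum_add_distrib,
    ← Finset.mul_sum, ← Finset.mul_sum, Finset.sum_add_distrib, Finset.sum_add_distrib,
    ← Finset.mul_sum] at hsum
  simp only [Finset.sum_const, Finset.card_range, nsmul_eq_mul] at hsum
  have hadj : ∑ j ∈ Finset.range K, (∫ s in Ioc (t (j + 1)) (t j), ∫ x, D x s ^ 2) =
      ∫ s in Ioc 0 t₁, ∫ x, D x s ^ 2 := by
    have h1 := intervalIntegral.sum_integral_adjacent_intervals (a := t) (n := K)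
      (f := fun s => ∫ x, D x s ^ 2) (μ := volume) (fun j hj => ?_)
    · rw [htK, ht0, intervalIntegral.integral_symm,
        intervalIntegral.integral_of_le ht₁] at h1
      rw [← neg_eq_iff_eq_neg] at h1
      rw [← h1, ← Finset.sum_neg_distrib]
      refine Finset.sum_congr rfl fun j _ => ?_
      rw [← intervalIntegral.integral_symm, intervalIntegral.integral_of_le]
      linarith [htstep j]
    · refine IntervalIntegrable.symm ?_
      rw [intervalIntegrable_iff_integrableOn_Ioc_of_le (by linarith [htstep j])]
      exact hdi.mono_set (hsub j hj)
  have hen := energy_dualSeq_le (ν := ν) (n := K) ham hκ.le ha0 haA hτ hcfl hθ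
  have hen0 : ∫ x, ψ K x * jump ν (ψ K) x ≤ 0 := integral_mul_jump_self_nonpos (hψn K)
  have hfin : ∫ x, W (t K) x * ψ K x ≤ 0 := by
    refine integral_nonpos fun x => ?_
    rw [htK]
    simp only [hW, intervalIntegral.integral_same, add_zero]
    exact mul_nonpos_of_nonpos_of_nonneg (hw₀n x) (hψ0 K x)
  rw [hadj, ht0] at hsum
  have hen1 : τ * ((σ / 2) * ∑ j ∈ Finset.range K, ∫ x, jump ν (ψ j) x ^ 2) ≤
      σ / (2 * κ) * (-∫ x, θ x * jump ν θ x) := by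
    have h1 : τ * ((σ / 2) * ∑ j ∈ Finset.range K, ∫ x, jump ν (ψ j) x ^ 2) =
        σ / (2 * κ) * (τ * κ * ∑ j ∈ Finset.range K, ∫ x, jump ν (ψ j) x ^ 2) := by
      field_simp
    rw [h1]
    refine mul_le_mul_of_nonneg_left ?_ (by positivity)
    refine hen.trans ?_
    linarith
  have hzero : ψ 0 = θ := rfl
  rw [hzero] at hsum
  have hKτ2 : ∀ c : ℝ, τ * (K * c) = t₁ * c := fun c => by rw [← hKτ]; ring
  rw [mul_add, mul_add, hKτ2, hKτ2] at hsum
  linarith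

end Duality

/-- Correlation in the space variable: `(x, t) ↦ ∫ k(y) f(x + y, t) dy`. -/
def corr (k : Euc N → ℝ) (f : Euc N → ℝ → ℝ) (x : Euc N) (t : ℝ) : ℝ :=
  ∫ y, k y * f (x + y) t

theorem measurable_shift {f : Euc N → ℝ → ℝ} (hf : Measurable (Function.uncurry f)) (x : Euc N)
    (t : ℝ) : Measurable (fun y => f (x + y) t) :=
  hf.comp ((measurable_const.add measurable_id).prodMk measurable_const)

theorem measurable_corr {k : Euc N → ℝ} {f : Euc N → ℝ → ℝ} (hk : Measurable k)
    (hf : Measurable (Function.uncurry f)) : Measurable (Function.uncurry (corr k f)) := by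
  have h : Measurable (fun q : (Euc N × ℝ) × Euc N => k q.2 * f (q.1.1 + q.2) q.1.2) :=
    (hk.comp measurable_snd).mul
      (hf.comp (((measurable_fst.comp measurable_fst).add measurable_snd).prodMk
        (measurable_snd.comp measurable_fst)))
  exact h.stronglyMeasurable.integral_prod_right.measurable

theorem integrable_corr_integrand {k : Euc N → ℝ} {f : Euc N → ℝ → ℝ} (hki : Integrable k)
    (hf : Measurable (Function.uncurry f)) {M : ℝ} (hM : ∀ x t, |f x t| ≤ M) (x : Euc N) (t : ℝ) :
    Integrable (fun y => k y * f (x + y) t) :=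
  hki.mul_bdd (measurable_shift hf x t).aestronglyMeasurable
    (Eventually.of_forall fun y => hM (x + y) t)

theorem abs_corr_le {k : Euc N → ℝ} {f : Euc N → ℝ → ℝ} (hki : Integrable k)
    {M : ℝ} (hM : ∀ x t, |f x t| ≤ M) (x : Euc N) (t : ℝ) :
    |corr k f x t| ≤ M * ∫ y, |k y| := by
  rw [← Real.norm_eq_abs, ← integral_const_mul]
  refine norm_integral_le_of_norm_le (hki.abs.const_mul M) (Eventually.of_forall fun y => ?_)
  rw [Real.norm_eq_abs, abs_mul, mul_comm]
  exact mul_le_mul_of_nonneg_right (hM _ _) (abs_nonneg _)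

theorem corr_sub_kernel {k l : Euc N → ℝ} {f : Euc N → ℝ → ℝ} (hki : Integrable k)
    (hli : Integrable l) (hf : Measurable (Function.uncurry f)) {M : ℝ}
    (hM : ∀ x t, |f x t| ≤ M) (x : Euc N) (t : ℝ) :
    corr k f x t - corr l f x t = corr (fun y => k y - l y) f x t := by
  simp only [corr]
  rw [← integral_sub (integrable_corr_integrand hki hf hM x t)
    (integrable_corr_integrand hli hf hM x t)]
  congr 1 with y
  ring

theorem corr_sub {k : Euc N → ℝ} {f g : Euc N → ℝ → ℝ} (hki : Integrable k)
    (hf : Measurable (Function.uncurry f)) {M : ℝ} (hM : ∀ x t, |f x t| ≤ M)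
    (hg : Measurable (Function.uncurry g)) {M' : ℝ} (hM' : ∀ x t, |g x t| ≤ M')
    (x : Euc N) (t : ℝ) :
    corr k (fun x t => f x t - g x t) x t = corr k f x t - corr k g x t := by
  simp only [corr]
  rw [← integral_sub (integrable_corr_integrand hki hf hM x t)
    (integrable_corr_integrand hki hg hM' x t)]
  congr 1 with y
  ring

theorem jump_corr {ν : Measure (Euc N)} [IsFiniteMeasure ν] [ν.IsNegInvariant] {ρ : Euc N → ℝ}
    {f : Euc N → ℝ → ℝ} (hρ : IsNice ρ) (hf : Measurable (Function.uncurry f)) {M : ℝ}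
    (hM : ∀ x t, |f x t| ≤ M) (x : Euc N) (t : ℝ) :
    jump ν (fun y => corr ρ f y t) x = corr (jump ν ρ) f x t := by
  have h1 : corr (jump ν ρ) f x t = ∫ y, f (x + y) t * jump ν ρ y := by
    simp only [corr, mul_comm]
  have hm : Measurable (fun y => corr ρ f y t) :=
    (measurable_corr hρ.measurable hf).comp measurable_prodMk_right
  rw [h1, integral_mul_jump_comm hρ (measurable_shift hf x t) (fun y => hM (x + y) t),
    integral_jump_mul hρ (measurable_shift hf x t) (fun y => hM (x + y) t),
    jump_eq hm (fun y => abs_corr_le hρ.integrable hM y t)]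
  have e : ∀ y z : Euc N, x + (y + z) = x + z + y := fun y z => by abel
  simp only [corr, e]

theorem measurePreserving_shift (T : ℝ) (y : Euc N) :
    MeasurePreserving (fun p : Euc N × ℝ => (p.1 + y, p.2)) (QTvol N T) (QTvol N T) :=
  (measurePreserving_add_right volume y).prod (MeasurePreserving.id _)

instance (T : ℝ) : SFinite (QTvol N T) := by unfold QTvol; infer_instance

instance (T : ℝ) : IsLocallyFiniteMeasure (QTvol N T) := by unfold QTvol; infer_instance

theorem tendsto_integral_shift_of_continuous (T : ℝ) {c : Euc N × ℝ → ℝ} (hc : Continuous c)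
    (hcs : HasCompactSupport c) :
    Tendsto (fun y : Euc N => ∫ p, |c (p.1 + y, p.2) - c p| ∂(QTvol N T)) (nhds 0) (nhds 0) := by
  obtain ⟨B, hB⟩ := hcs.exists_bound_of_continuous hc
  have hK : IsCompact (Metric.cthickening 1 (tsupport c)) := hcs.isCompact.cthickening
  have h := tendsto_integral_filter_of_dominated_convergence (μ := QTvol N T) (l := nhds (0 : Euc N))
    (F := fun (y : Euc N) (p : Euc N × ℝ) => |c (p.1 + y, p.2) - c p|) (f := fun _ => 0)
    ((Metric.cthickening 1 (tsupport c)).indicator fun _ => 2 * B) ?_ ?_ ?_ ?_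
  · simpa using h
  · exact Eventually.of_forall fun y => Continuous.aestronglyMeasurable (by fun_prop)
  · filter_upwards [Metric.closedBall_mem_nhds (0 : Euc N) one_pos] with y hy
    refine Eventually.of_forall fun p => ?_
    rw [Real.norm_eq_abs, abs_abs]
    by_cases hp : p ∈ Metric.cthickening 1 (tsupport c)
    · rw [indicator_of_mem hp]
      have h1 := abs_sub (c (p.1 + y, p.2)) (c p)
      have h2 : |c (p.1 + y, p.2)| ≤ B := hB _
      have h3 : |c p| ≤ B := hB _
      linarith
    · rw [indicator_of_notMem hp]
      have h1 : c p = 0 := image_eq_zero_of_notMem_tsupport fun h =>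
        hp (Metric.self_subset_cthickening _ h)
      have h2 : c (p.1 + y, p.2) = 0 := image_eq_zero_of_notMem_tsupport fun h => by
        refine hp (Metric.mem_cthickening_of_dist_le p _ 1 _ h ?_)
        rw [Prod.dist_eq]
        simpa using hy
      simp [h1, h2]
  · rw [integrable_indicator_iff hK.isClosed.measurableSet]
    exact integrableOn_const hK.measure_lt_top.ne
  · refine Eventually.of_forall fun p => ?_
    have : Continuous fun y : Euc N => |c (p.1 + y, p.2) - c p| := by fun_prop
    simpa using this.tendsto 0

theorem exists_integral_shift_le {T : ℝ} {f : Euc N × ℝ → ℝ} (hf : Integrable f (QTvol N T))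
    {ε : ℝ} (hε : 0 < ε) :
    ∃ δ > 0, ∀ y : Euc N, ‖y‖ < δ → ∫ p, |f (p.1 + y, p.2) - f p| ∂(QTvol N T) ≤ ε := by
  obtain ⟨c, hcs, hfc, hc, hci⟩ :=
    hf.exists_hasCompactSupport_integral_sub_le (ε := ε / 3) (by positivity)
  have h := tendsto_integral_shift_of_continuous T hc hcs
  obtain ⟨δ, hδ, hδ'⟩ := Metric.tendsto_nhds_nhds.1 h (ε / 3) (by positivity)
  refine ⟨δ, hδ, fun y hy => ?_⟩
  have h1 : ∫ p, |c (p.1 + y, p.2) - c p| ∂(QTvol N T) ≤ ε / 3 := by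
    have := hδ' (x := y) (by simpa using hy)
    rw [Real.dist_eq, sub_zero] at this
    exact (le_abs_self _).trans this.le
  have hS := measurePreserving_shift (N := N) T y
  have hemb : MeasurableEmbedding (fun p : Euc N × ℝ => (p.1 + y, p.2)) :=
    ((MeasurableEquiv.addRight y).prodCongr (MeasurableEquiv.refl ℝ)).measurableEmbedding
  have hfci : Integrable (fun p => |f p - c p|) (QTvol N T) := (hf.sub hci).abs
  have h2 : ∫ p : Euc N × ℝ, |f (p.1 + y, p.2) - c (p.1 + y, p.2)| ∂(QTvol N T) ≤ ε / 3 :=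
    (hS.integral_comp hemb (fun p => |f p - c p|)).le.trans hfc
  have i1 : Integrable (fun p : Euc N × ℝ => |f (p.1 + y, p.2) - c (p.1 + y, p.2)|) (QTvol N T) :=
    hS.integrable_comp_of_integrable hfci
  have i2 : Integrable (fun p : Euc N × ℝ => |c (p.1 + y, p.2) - c p|) (QTvol N T) :=
    ((hS.integrable_comp_of_integrable hci).sub hci).abs
  have i3 : Integrable (fun p : Euc N × ℝ => |f (p.1 + y, p.2) - f p|) (QTvol N T) :=
    ((hS.integrable_comp_of_integrable hf).sub hf).abs
  have h3 : ∫ p, |f (p.1 + y, p.2) - f p| ∂(QTvol N T) ≤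
      ∫ p, (|f (p.1 + y, p.2) - c (p.1 + y, p.2)| + |c (p.1 + y, p.2) - c p| + |f p - c p|)
        ∂(QTvol N T) := by
    refine integral_mono i3 ((i1.add i2).add hfci) fun p => ?_
    have e : f (p.1 + y, p.2) - f p = (f (p.1 + y, p.2) - c (p.1 + y, p.2)) +
      (c (p.1 + y, p.2) - c p) - (f p - c p) := by ring
    simp only [e]
    exact (abs_sub _ _).trans (add_le_add_left (abs_add_le _ _) _)
  have i12 : Integrable (fun p : Euc N × ℝ => |f (p.1 + y, p.2) - c (p.1 + y, p.2)| +
    |c (p.1 + y, p.2) - c p|) (QTvol N T) := i1.add i2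
  rw [integral_add i12 hfci, integral_add i1 i2] at h3
  have h4 : ∫ p, |f p - c p| ∂(QTvol N T) ≤ ε / 3 := hfc
  linarith

/-- A smooth probability density supported in the ball of radius `δ`. -/
structure IsMollifier (δ : ℝ) (ρ : Euc N → ℝ) : Prop where
  isTestFn : IsTestFn ρ
  nonneg : ∀ y, 0 ≤ ρ y
  integral_eq_one : ∫ y, ρ y = 1
  eq_zero : ∀ y, δ ≤ ‖y‖ → ρ y = 0

theorem exists_isMollifier {δ : ℝ} (hδ : 0 < δ) : ∃ ρ : Euc N → ℝ, IsMollifier δ ρ := by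
  let b : ContDiffBump (0 : Euc N) := ⟨δ / 2, δ, by positivity, by linarith⟩
  refine ⟨b.normed volume, ⟨b.contDiff_normed, b.hasCompactSupport_normed⟩, b.nonneg_normed,
    b.integral_normed, fun y hy => ?_⟩
  have : y ∉ Function.support (b.normed volume) := by
    rw [b.support_normed_eq]
    simpa [b] using hy
  simpa using this

theorem exists_integral_corr_sub_le {T : ℝ} {f : Euc N → ℝ → ℝ}
    (hfm : Measurable (Function.uncurry f)) {M : ℝ} (hM : ∀ x t, |f x t| ≤ M)
    (hf : Integrable (Function.uncurry f) (QTvol N T)) {ε : ℝ} (hε : 0 < ε) :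
    ∃ δ > 0, ∀ ρ : Euc N → ℝ, IsMollifier δ ρ →
      Integrable (fun p : Euc N × ℝ => |corr ρ f p.1 p.2 - f p.1 p.2|) (QTvol N T) ∧
      ∫ p, |corr ρ f p.1 p.2 - f p.1 p.2| ∂(QTvol N T) ≤ ε := by
  obtain ⟨δ, hδ, hsh⟩ := exists_integral_shift_le hf hε
  refine ⟨δ, hδ, fun ρ hρ => ?_⟩
  have hρn := hρ.isTestFn.isNice
  have hρm := hρn.measurable
  set d : Euc N × ℝ → Euc N → ℝ := fun p y =>
    ρ y * (f (p.1 + y) p.2 - f p.1 p.2) with hd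
  have hdm : Measurable (Function.uncurry d) := by
    refine (hρm.comp measurable_snd).mul (Measurable.sub ?_ (hfm.comp measurable_fst))
    exact hfm.comp (((measurable_fst.comp measurable_fst).add measurable_snd).prodMk
        (measurable_snd.comp measurable_fst))
  have hsi : ∀ y, Integrable (fun p : Euc N × ℝ => f (p.1 + y) p.2 - f p.1 p.2) (QTvol N T) :=
    fun y => ((measurePreserving_shift (N := N) T y).integrable_comp_of_integrable hf).sub hf
  have hyb : ∀ y, ∫ p, ‖d p y‖ ∂(QTvol N T) ≤ ε * ρ y := fun y => by
    have e : ∀ p, ‖d p y‖ = ρ y * |f (p.1 + y) p.2 - f p.1 p.2| := fun p => by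
      rw [Real.norm_eq_abs, abs_mul, abs_of_nonneg (hρ.nonneg y)]
    simp only [e]
    rw [integral_const_mul, mul_comm]
    by_cases hy : ‖y‖ < δ
    · exact mul_le_mul_of_nonneg_right (hsh y hy) (hρ.nonneg y)
    · rw [hρ.eq_zero y (not_lt.1 hy)]; simp
  have hdi : Integrable (Function.uncurry d) ((QTvol N T).prod volume) := by
    rw [integrable_prod_iff' hdm.aestronglyMeasurable]
    refine ⟨Eventually.of_forall fun y => (hsi y).const_mul (ρ y), ?_⟩
    refine (hρn.integrable.const_mul ε).mono' ?_ (Eventually.of_forall fun y => ?_)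
    · exact (hdm.norm.stronglyMeasurable.integral_prod_left (μ := QTvol N T)).aestronglyMeasurable
    · rw [Real.norm_eq_abs, abs_of_nonneg (integral_nonneg fun p => norm_nonneg _)]
      exact hyb y
  have hval : ∀ p : Euc N × ℝ, corr ρ f p.1 p.2 - f p.1 p.2 = ∫ y, d p y := fun p => by
    have e : ∀ y, d p y = ρ y * f (p.1 + y) p.2 - ρ y * f p.1 p.2 := fun y => by
      simp only [hd]; ring
    simp only [e]
    rw [integral_sub (integrable_corr_integrand hρn.integrable hfm hM p.1 p.2)
      (hρn.integrable.mul_const _), integral_mul_const, hρ.integral_eq_one, one_mul]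
    rfl
  have hintg : Integrable (fun p : Euc N × ℝ => |corr ρ f p.1 p.2 - f p.1 p.2|) (QTvol N T) := by
    simp only [hval]
    exact hdi.integral_prod_left.abs
  refine ⟨hintg, ?_⟩
  calc ∫ p, |corr ρ f p.1 p.2 - f p.1 p.2| ∂(QTvol N T)
      ≤ ∫ p, (∫ y, ‖d p y‖) ∂(QTvol N T) := by
        refine integral_mono hintg hdi.norm.integral_prod_left fun p => ?_
        rw [hval]
        exact norm_integral_le_integral_norm (d p)
    _ = ∫ y, (∫ p, ‖d p y‖ ∂(QTvol N T)) :=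
        integral_integral_swap (f := fun p y => ‖d p y‖) hdi.norm
    _ ≤ ∫ y, ε * ρ y := integral_mono hdi.norm.integral_prod_right (hρn.integrable.const_mul ε) hyb
    _ = ε := by rw [integral_const_mul, hρ.integral_eq_one, mul_one]

theorem exists_measurable_bounded_rep {α : Type*} [MeasurableSpace α] {m : Measure α} {f : α → ℝ}
    (hf : AEStronglyMeasurable f m) {C : ℝ} (hC : ∀ᵐ x ∂m, |f x| ≤ C) :
    ∃ g : α → ℝ, Measurable g ∧ (∀ x, |g x| ≤ |C|) ∧ f =ᵐ[m] g := by
  refine ⟨fun x => max (-|C|) (min |C| (hf.mk f x)),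
    measurable_const.max (measurable_const.min hf.stronglyMeasurable_mk.measurable), fun x => ?_, ?_⟩
  · rw [abs_le]
    exact ⟨le_max_left _ _, max_le (by linarith [abs_nonneg C]) (min_le_left _ _)⟩
  · filter_upwards [hC, hf.ae_eq_mk] with x hx he
    have := abs_le.1 (hx.trans (le_abs_self C))
    rw [← he, min_eq_right this.2, max_eq_right this.1]

theorem ae_ae_of_ae_QTvol {T : ℝ} {P : Euc N × ℝ → Prop} (h : ∀ᵐ p ∂(QTvol N T), P p) :
    ∀ᵐ t ∂(volume.restrict (Ioo 0 T)), ∀ᵐ x, P (x, t) :=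
  Measure.ae_ae_of_ae_prod (Measure.measurePreserving_swap.quasiMeasurePreserving.ae h)

theorem IsDistSolOp.congr {T : ℝ} {A : (Euc N → ℝ) → Euc N → ℝ} {φ : ℝ → ℝ} {u0 v0 : Euc N → ℝ}
    {u v : Euc N → ℝ → ℝ} (h : IsDistSolOp T A φ u0 u) (h0 : u0 =ᵐ[volume] v0)
    (huv : ∀ᵐ p ∂(QTvol N T), u p.1 p.2 = v p.1 p.2) : IsDistSolOp T A φ v0 v := by
  intro ψ hψ
  refine Eq.trans ?_ (h ψ hψ)
  congr 1
  · refine integral_congr_ae ?_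
    filter_upwards [ae_ae_of_ae_QTvol huv] with t ht
    refine integral_congr_ae ?_
    filter_upwards [ht] with x hx
    rw [hx]
  · refine integral_congr_ae ?_
    filter_upwards [h0] with x hx
    rw [hx]

theorem integral_mul_integral_Ioo_swap {T : ℝ} {H ξ : ℝ → ℝ} (hH : IntegrableOn H (Ioo 0 T))
    (hξ : Continuous ξ) :
    ∫ t in Ioo 0 T, H t * (∫ s in t..T, ξ s) = ∫ s in Ioo 0 T, ξ s * ∫ t in (0 : ℝ)..s, H t := by
  have hξi : IntegrableOn ξ (Ioo 0 T) := hξ.integrableOn_Icc.mono_set Ioo_subset_Icc_self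
  have hF : Integrable ({q : ℝ × ℝ | q.1 < q.2}.indicator fun q => H q.1 * ξ q.2)
      ((volume.restrict (Ioo 0 T)).prod (volume.restrict (Ioo 0 T))) :=
    (hH.mul_prod hξi).indicator (measurableSet_lt measurable_fst measurable_snd)
  have hsw := integral_integral_swap (f := fun t s =>
    ({q : ℝ × ℝ | q.1 < q.2}.indicator fun q => H q.1 * ξ q.2) (t, s)) hF
  calc ∫ t in Ioo 0 T, H t * (∫ s in t..T, ξ s) = _ := ?_
    _ = _ := hsw
    _ = _ := ?_
  · refine setIntegral_congr_fun measurableSet_Ioo fun t ht => ?_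
    have e : (fun s => ({q : ℝ × ℝ | q.1 < q.2}.indicator fun q => H q.1 * ξ q.2) (t, s)) =
      (Ioi t).indicator fun s => H t * ξ s := by
      ext s; simp [indicator]
    simp only [e]
    rw [setIntegral_indicator measurableSet_Ioi, integral_const_mul,
      intervalIntegral.integral_of_le ht.2.le, integral_Ioc_eq_integral_Ioo]
    congr 3
    ext s
    simp only [mem_inter_iff, mem_Ioo, mem_Ioi]
    have := ht.1
    constructor
    · rintro ⟨h1, h2⟩; exact ⟨⟨by linarith, h2⟩, h1⟩
    · rintro ⟨⟨_, h2⟩, h1⟩; exact ⟨h1, h2⟩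
  · refine setIntegral_congr_fun measurableSet_Ioo fun s hs => ?_
    have e : (fun t => ({q : ℝ × ℝ | q.1 < q.2}.indicator fun q => H q.1 * ξ q.2) (t, s)) =
      (Iio s).indicator fun t => ξ s * H t := by
      ext t; simp [indicator, mul_comm]
    simp only [e]
    rw [setIntegral_indicator measurableSet_Iio, integral_const_mul,
      intervalIntegral.integral_of_le hs.1.le, integral_Ioc_eq_integral_Ioo]
    congr 3
    ext t
    simp only [mem_inter_iff, mem_Ioo, mem_Iio]
    have := hs.2
    constructor
    · rintro ⟨⟨h1, _⟩, h2⟩; exact ⟨h1, h2⟩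
    · rintro ⟨h1, h2⟩; exact ⟨⟨h1, by linarith⟩, h2⟩

/-- A compactly supported smooth antiderivative on `(0, T)`, vanishing near `T`. -/
theorem exists_antideriv_test {T : ℝ} {ξ : ℝ → ℝ} (hξ : ContDiff ℝ (⊤ : ℕ∞) ξ)
    (hξc : HasCompactSupport ξ) (hξs : tsupport ξ ⊆ Ioo 0 T) :
    ∃ η : ℝ → ℝ, ContDiff ℝ (⊤ : ℕ∞) η ∧ HasCompactSupport η ∧ tsupport η ⊆ Iio T ∧
      (∀ t, 0 < t → deriv η t = ξ t) ∧ ∀ t, 0 ≤ t → η t = -∫ s in t..T, ξ s := by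
  obtain ⟨b, hbT, hb⟩ : ∃ b < T, ∀ s, b < s → ξ s = 0 := by
    by_cases hne : (tsupport ξ).Nonempty
    · obtain ⟨m, hm, hmax⟩ := hξc.isCompact.exists_isGreatest hne
      refine ⟨m, (hξs hm).2, fun s hs => image_eq_zero_of_notMem_tsupport fun h => ?_⟩
      exact absurd (hmax h) (not_le.2 hs)
    · refine ⟨T - 1, by linarith, fun s _ => image_eq_zero_of_notMem_tsupport fun h => hne ⟨s, h⟩⟩
  set P : ℝ → ℝ := fun t => ∫ s in T..t, ξ s with hP
  have hPd : ∀ t, HasDerivAt P (ξ t) t := fun t =>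
    hξ.continuous.integral_hasStrictDerivAt T t |>.hasDerivAt
  have hPc : ContDiff ℝ (⊤ : ℕ∞) P := by
    rw [contDiff_infty_iff_deriv]
    refine ⟨fun t => (hPd t).differentiableAt, ?_⟩
    rwa [show deriv P = ξ from funext fun t => (hPd t).deriv]
  have hP0 : ∀ t, b ≤ t → P t = 0 := fun t ht => by
    simp only [hP]
    rw [intervalIntegral.integral_zero_ae]
    refine Eventually.of_forall fun s hs => hb s ?_
    rw [mem_uIoc] at hs
    rcases hs with hs | hs <;> linarith [hs.1]
  set χ : ℝ → ℝ := fun t => Real.smoothTransition (t + 2) with hχ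
  have hχ1 : ∀ t, -1 ≤ t → χ t = 1 := fun t ht =>
    Real.smoothTransition.one_of_one_le (by linarith)
  have hχ0 : ∀ t, t ≤ -2 → χ t = 0 := fun t ht =>
    Real.smoothTransition.zero_of_nonpos (by linarith)
  have hχc : ContDiff ℝ (⊤ : ℕ∞) χ :=
    Real.smoothTransition.contDiff.comp (contDiff_id.add contDiff_const)
  have hsup : tsupport (fun t => χ t * P t) ⊆ Icc (-2) b := by
    refine closure_minimal (fun t ht => ?_) isClosed_Icc
    by_contra hn
    rw [mem_Icc, not_and_or, not_le, not_le] at hn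
    rcases hn with hn | hn
    · exact ht (by simp [hχ0 t hn.le])
    · exact ht (by simp [hP0 t hn.le])
  refine ⟨fun t => χ t * P t, hχc.mul hPc, ?_, fun t ht => (hsup ht).2.trans_lt hbT,
    fun t ht => ?_, fun t ht => ?_⟩
  · exact isCompact_Icc.of_isClosed_subset (isClosed_tsupport _) hsup
  · have : (fun t => χ t * P t) =ᶠ[nhds t] P := by
      filter_upwards [Ioi_mem_nhds ht] with s hs
      rw [hχ1 s (by linarith [mem_Ioi.1 hs]), one_mul]
    rw [this.deriv_eq, (hPd t).deriv]
  · simp only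
    rw [hχ1 t (by linarith), one_mul, intervalIntegral.integral_symm, neg_neg]

theorem ae_eq_add_integral_of_weak {T : ℝ} (hT : 0 < T) {f H : ℝ → ℝ}
    (hf : IntegrableOn f (Ioo 0 T)) (hH : IntegrableOn H (Ioo 0 T)) {c : ℝ}
    (h : ∀ η : ℝ → ℝ, ContDiff ℝ (⊤ : ℕ∞) η → HasCompactSupport η → tsupport η ⊆ Iio T →
      (∫ t in Ioo 0 T, (f t * deriv η t + H t * η t)) + c * η 0 = 0) :
    ∀ᵐ t ∂(volume.restrict (Ioo 0 T)), f t = c + ∫ s in (0 : ℝ)..t, H s := by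
  have hHc : ContinuousOn (fun t => ∫ s in (0 : ℝ)..t, H s) (Icc 0 T) :=
    intervalIntegral.continuousOn_primitive_interval
      (by rwa [uIcc_of_le hT.le, integrableOn_Icc_iff_integrableOn_Ioo]) |>.mono
      (by rw [uIcc_of_le hT.le])
  have hFi : IntegrableOn (fun t => c + ∫ s in (0 : ℝ)..t, H s) (Ioo 0 T) :=
    ((continuousOn_const.add hHc).integrableOn_Icc).mono_set Ioo_subset_Icc_self
  have key := isOpen_Ioo.ae_eq_zero_of_integral_contDiff_smul_eq_zero (μ := volume)
    (U := Ioo 0 T) (f := fun t => f t - (c + ∫ s in (0 : ℝ)..t, H s))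
    (hf.sub hFi).locallyIntegrableOn ?_
  · rw [ae_restrict_iff' measurableSet_Ioo]
    filter_upwards [key] with t ht hm
    linarith [ht hm]
  intro ξ hξ hξc hξs
  obtain ⟨η, hη, hηc, hηs, hηd, hηv⟩ := exists_antideriv_test hξ hξc hξs
  have hξcont := hξ.continuous
  obtain ⟨B, hB⟩ := hξc.exists_bound_of_continuous hξcont
  have h1 := h η hη hηc hηs
  have i1 : IntegrableOn (fun t => f t * ξ t) (Ioo 0 T) :=
    hf.mul_bdd hξcont.aestronglyMeasurable (Eventually.of_forall hB)
  obtain ⟨B', hB'⟩ := hηc.exists_bound_of_continuous hη.continuous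
  have i2 : IntegrableOn (fun t => H t * η t) (Ioo 0 T) :=
    hH.mul_bdd hη.continuous.aestronglyMeasurable (Eventually.of_forall hB')
  have e1 : ∫ t in Ioo 0 T, (f t * deriv η t + H t * η t) =
      (∫ t in Ioo 0 T, f t * ξ t) + ∫ t in Ioo 0 T, H t * η t := by
    rw [← integral_add i1 i2]
    refine setIntegral_congr_fun measurableSet_Ioo fun t ht => ?_
    rw [hηd t ht.1]
  have e2 : ∫ t in Ioo 0 T, H t * η t = - ∫ s in Ioo 0 T, ξ s * ∫ t in (0 : ℝ)..s, H t := by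
    rw [← integral_mul_integral_Ioo_swap hH hξcont, ← integral_neg]
    refine setIntegral_congr_fun measurableSet_Ioo fun t ht => ?_
    rw [hηv t ht.1.le, mul_neg]
  have e3 : η 0 = -∫ s in Ioo 0 T, ξ s := by
    rw [hηv 0 le_rfl, intervalIntegral.integral_of_le hT.le, integral_Ioc_eq_integral_Ioo]
  have i3 : IntegrableOn (fun t => ξ t * ∫ s in (0 : ℝ)..t, H s) (Ioo 0 T) :=
    ((hξcont.continuousOn.mul hHc).integrableOn_Icc).mono_set Ioo_subset_Icc_self
  have i4 : IntegrableOn (fun t => ξ t * c) (Ioo 0 T) :=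
    ((hξcont.continuousOn.mul continuousOn_const).integrableOn_Icc).mono_set Ioo_subset_Icc_self
  have e4 : ∫ t, ξ t • (f t - (c + ∫ s in (0 : ℝ)..t, H s)) =
      (∫ t in Ioo 0 T, f t * ξ t) - (∫ t in Ioo 0 T, ξ t * c) -
        ∫ t in Ioo 0 T, ξ t * ∫ s in (0 : ℝ)..t, H s := by
    have i5 : IntegrableOn (fun t => f t * ξ t - ξ t * c) (Ioo 0 T) := i1.sub i4
    rw [← setIntegral_eq_integral_of_forall_compl_eq_zero (s := Ioo 0 T), ← integral_sub i1 i4,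
      ← integral_sub i5 i3]
    · congr 1 with t
      simp only [smul_eq_mul]
      ring
    · intro t ht
      rw [image_eq_zero_of_notMem_tsupport fun h => ht (hξs h), zero_smul]
  rw [e4, integral_mul_const]
  rw [e1, e2, e3] at h1
  linarith

theorem Lop_shift_mul (μ : Measure (Euc N)) {ρ : Euc N → ℝ} (hρ : IsTestFn ρ) (c : ℝ) (x y : Euc N) :
    Lop μ (fun y => ρ (y - x) * c) y = Lop μ ρ (y - x) * c := by
  have hd : ∀ z, fderiv ℝ (fun y => ρ (y - x) * c) y z = fderiv ℝ ρ (y - x) z * c := fun z => by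
    have h1 : HasFDerivAt ρ (fderiv ℝ ρ (y - x)) (y - x) :=
      ((hρ.1.differentiable (by simp)) (y - x)).hasFDerivAt
    have h2 : HasFDerivAt (fun y => ρ (y - x) * c) (c • fderiv ℝ ρ (y - x)) y := by
      have := (h1.comp y ((hasFDerivAt_id y).sub_const x)).mul_const c
      simpa using this
    rw [h2.fderiv]
    simp [mul_comm]
  simp only [Lop, hd]
  rw [← integral_mul_const]
  congr 1 with z
  rw [show y + z - x = y - x + z by abel]
  split_ifs <;> ring

/-- Mollified form of the equation, integrated in time. -/
theorem IsDistSolOp.corr_eq {μ : Measure (Euc N)} (hμ : IsLevyMeasure μ) {T : ℝ} (hT : 0 < T)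
    {φ : ℝ → ℝ} (hφ : Continuous φ) {u0 : Euc N → ℝ} {u : Euc N → ℝ → ℝ}
    (hum : Measurable (Function.uncurry u)) {M M' : ℝ} (hM : ∀ x t, |u x t| ≤ M)
    (hM' : ∀ x t, |φ (u x t)| ≤ M') (h : IsDistSolOp T (Lop μ) φ u0 u)
    {ρ : Euc N → ℝ} (hρ : IsTestFn ρ) (x : Euc N) :
    ∀ᵐ t ∂(volume.restrict (Ioo 0 T)), corr ρ u x t = (∫ y, ρ y * u0 (x + y)) +
      ∫ s in (0 : ℝ)..t, corr (Lop μ ρ) (fun x t => φ (u x t)) x s := by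
  obtain ⟨ν, -, -, hν⟩ := hμ.exists_approx
  obtain ⟨hLm, hLi, -⟩ := hν ρ hρ
  have hφm : Measurable (Function.uncurry fun x t => φ (u x t)) := hφ.measurable.comp hum
  have bdd : ∀ {k : Euc N → ℝ} {f : Euc N → ℝ → ℝ} {C : ℝ}, Measurable k → Integrable k →
      Measurable (Function.uncurry f) → (∀ x t, |f x t| ≤ C) →
      IntegrableOn (corr k f x) (Ioo 0 T) := fun hk hki hf hC =>
    Measure.integrableOn_of_bounded (by simp)
      ((measurable_corr hk hf).comp measurable_prodMk_left).aestronglyMeasurable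
      (Eventually.of_forall fun s => abs_corr_le hki hC x s)
  have hρn := hρ.isNice
  refine ae_eq_add_integral_of_weak hT (bdd hρn.measurable hρn.integrable hum hM)
    (bdd hLm hLi hφm hM') fun η hη hηc hηs => ?_
  have hψ : IsSTTestFn T (fun y t => ρ (y - x) * η t) := by
    have hs : tsupport (Function.uncurry fun y t => ρ (y - x) * η t) ⊆
        (image (fun y => y + x) (tsupport ρ)) ×ˢ tsupport η := by
      refine closure_minimal (fun p hp => ?_)
        (((hρ.2.isCompact.image (by fun_prop)).isClosed).prod (isClosed_tsupport _))
      simp only [Function.mem_support, Function.uncurry, ne_eq, mul_eq_zero, not_or] at hp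
      exact ⟨⟨p.1 - x, subset_tsupport _ hp.1, by simp⟩, subset_tsupport _ hp.2⟩
    refine ⟨?_, ?_, fun p hp => hηs (hs hp).2⟩
    · exact (hρ.1.comp (contDiff_fst.sub contDiff_const)).mul (hη.comp contDiff_snd)
    · exact ((hρ.2.isCompact.image (by fun_prop)).prod hηc.isCompact).of_isClosed_subset
        (isClosed_tsupport _) hs
  have h1 := h _ hψ
  have hdη : ∀ y t, deriv (fun t => ρ (y - x) * η t) t = ρ (y - x) * deriv η t := fun y t =>
    deriv_const_mul _ ((hη.differentiable (by simp)) t)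
  simp only [Lop_shift_mul μ hρ, hdη] at h1
  refine Eq.trans ?_ h1
  congr 1
  · refine integral_congr_ae (Eventually.of_forall fun t => ?_)
    simp only
    rw [← integral_add_left_eq_self _ x]
    have i1 := (integrable_corr_integrand hρn.integrable hum hM x t).mul_const (deriv η t)
    have i2 := (integrable_corr_integrand hLi hφm hM' x t).mul_const (η t)
    simp only [corr]
    rw [← integral_mul_const, ← integral_mul_const, ← integral_add i1 i2]
    congr 1 with y
    rw [add_sub_cancel_left]
    ring
  · rw [← integral_add_left_eq_self (fun y => u0 y * (ρ (y - x) * η 0)) x, ← integral_mul_const]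
    congr 1 with y
    rw [add_sub_cancel_left]
    ring

/-- The right-hand side of the mollified equation integrated in time. -/
def evolved (μ : Measure (Euc N)) (ρ w0 : Euc N → ℝ) (g : Euc N → ℝ → ℝ) (x : Euc N) (t : ℝ) : ℝ :=
  corr ρ (fun x _ => w0 x) x 0 + ∫ s in (0 : ℝ)..t, corr (Lop μ ρ) g x s

/-- The problem `∂_t w = L^μ[g]`, `w(0) = w0 ≤ 0` solved by the difference `w` of two solutions,
where `g` is the difference of the nonlinearities. -/
structure DifferenceProblem (μ : Measure (Euc N)) (T M : ℝ) (w0 : Euc N → ℝ)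
    (w g : Euc N → ℝ → ℝ) : Prop where
  levy : IsLevyMeasure μ
  pos : 0 < T
  measurable_w0 : Measurable w0
  measurable_w : Measurable (Function.uncurry w)
  measurable_g : Measurable (Function.uncurry g)
  abs_w0_le : ∀ x, |w0 x| ≤ M
  abs_w_le : ∀ x t, |w x t| ≤ M
  abs_g_le : ∀ x t, |g x t| ≤ M
  integrable : Integrable (Function.uncurry w) (QTvol N T)
  nonpos : ∀ᵐ x, w0 x ≤ 0
  sign : ∀ x t, 0 ≤ g x t * w x t
  modulus : ∀ η > 0, ∃ c > 0, ∀ x t, |w x t| < c → |g x t| ≤ η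
  eqn : ∀ ρ : Euc N → ℝ, IsTestFn ρ → ∀ x, ∀ᵐ t ∂(volume.restrict (Ioo 0 T)),
    corr ρ w x t = evolved μ ρ w0 g x t

theorem integrable_of_abs_le {α : Type*} [MeasurableSpace α] {m : Measure α} {f g : α → ℝ}
    (hg : Integrable g m) (hf : Measurable f) (h : ∀ x, |f x| ≤ g x) : Integrable f m :=
  hg.mono' hf.aestronglyMeasurable (Eventually.of_forall h)

theorem measurable_corr_Lop {μ : Measure (Euc N)} (hμ : IsLevyMeasure μ) {ρ : Euc N → ℝ}
    (hρ : IsTestFn ρ) {g : Euc N → ℝ → ℝ} (hg : Measurable (Function.uncurry g)) :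
    Measurable (Function.uncurry (corr (Lop μ ρ) g)) := by
  obtain ⟨ν, -, -, hν⟩ := hμ.exists_approx
  exact measurable_corr (hν ρ hρ).1 hg

theorem measurable_evolved {μ : Measure (Euc N)} (hμ : IsLevyMeasure μ) {ρ : Euc N → ℝ}
    (hρ : IsTestFn ρ) {w0 : Euc N → ℝ} (hw0 : Measurable w0) {g : Euc N → ℝ → ℝ}
    (hg : Measurable (Function.uncurry g)) :
    Measurable (fun p : Euc N × ℝ => corr ρ (fun x _ => w0 x) p.1 0 +
      ∫ s, (Ioc 0 p.2).indicator (corr (Lop μ ρ) g p.1) s) := by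
  have h0 : Measurable (Function.uncurry (corr ρ fun x (_ : ℝ) => w0 x)) :=
    measurable_corr hρ.isNice.measurable (hw0.comp measurable_fst)
  have h1 : Measurable (fun p : Euc N × ℝ => corr ρ (fun x _ => w0 x) p.1 0) :=
    (h0.comp (measurable_prodMk_right (y := (0 : ℝ)))).comp measurable_fst
  refine h1.add ?_
  have hm : Measurable (fun q : (Euc N × ℝ) × ℝ =>
      (Ioc 0 q.1.2).indicator (corr (Lop μ ρ) g q.1.1) q.2) := by
    have e : (fun q : (Euc N × ℝ) × ℝ => (Ioc 0 q.1.2).indicator (corr (Lop μ ρ) g q.1.1) q.2) =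
        {q : (Euc N × ℝ) × ℝ | 0 < q.2 ∧ q.2 ≤ q.1.2}.indicator
          fun q => corr (Lop μ ρ) g q.1.1 q.2 := by
      ext q; simp [indicator]
    rw [e]
    refine Measurable.indicator ?_ ?_
    · exact (measurable_corr_Lop hμ hρ hg).comp
        ((measurable_fst.comp measurable_fst).prodMk measurable_snd)
    · exact (measurableSet_lt measurable_const measurable_snd).inter
        (measurableSet_le measurable_snd (measurable_snd.comp measurable_fst))
  exact hm.stronglyMeasurable.integral_prod_right.measurable

theorem evolved_eq {μ : Measure (Euc N)} {ρ w0 : Euc N → ℝ} {g : Euc N → ℝ → ℝ} (x : Euc N) {t : ℝ}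
    (ht : 0 ≤ t) : evolved μ ρ w0 g x t = corr ρ (fun x _ => w0 x) x 0 +
      ∫ s, (Ioc 0 t).indicator (corr (Lop μ ρ) g x) s := by
  rw [evolved, intervalIntegral.integral_of_le ht, integral_indicator measurableSet_Ioc]

namespace DifferenceProblem

variable {μ : Measure (Euc N)} {T M : ℝ} {w0 : Euc N → ℝ} {w g : Euc N → ℝ → ℝ}

theorem bound_nonneg (h : DifferenceProblem μ T M w0 w g) : 0 ≤ M :=
  (abs_nonneg _).trans (h.abs_w0_le 0)

theorem ae_ae_eqn (h : DifferenceProblem μ T M w0 w g) {ρ : Euc N → ℝ} (hρ : IsTestFn ρ) :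
    ∀ᵐ t ∂(volume.restrict (Ioo 0 T)), ∀ᵐ x, corr ρ w x t = evolved μ ρ w0 g x t := by
  have hm := measurable_evolved h.levy hρ h.measurable_w0 h.measurable_g
  have hw := measurable_corr hρ.isNice.measurable h.measurable_w
  have hset : MeasurableSet {p : Euc N × ℝ | corr ρ w p.1 p.2 = corr ρ (fun x _ => w0 x) p.1 0 +
      ∫ s, (Ioc 0 p.2).indicator (corr (Lop μ ρ) g p.1) s} := measurableSet_eq_fun hw hm
  have h1 : ∀ᵐ x : Euc N, ∀ᵐ t ∂(volume.restrict (Ioo 0 T)), corr ρ w x t =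
      corr ρ (fun x _ => w0 x) x 0 + ∫ s, (Ioc 0 t).indicator (corr (Lop μ ρ) g x) s := by
    refine Eventually.of_forall fun x => ?_
    filter_upwards [h.eqn ρ hρ x, ae_restrict_mem measurableSet_Ioo] with t ht hmem
    rw [ht, evolved_eq x hmem.1.le]
  have h2 := (Measure.ae_ae_comm hset).1 h1
  filter_upwards [h2, ae_restrict_mem measurableSet_Ioo] with t ht hmem
  filter_upwards [ht] with x hx
  rw [hx, evolved_eq x hmem.1.le]

/-- Up to a uniformly small error, `g` is a bounded nonnegative multiple of `w`. -/
theorem exists_coefficient (h : DifferenceProblem μ T M w0 w g) {η : ℝ} (hη : 0 < η) :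
    ∃ A : ℝ, 0 ≤ A ∧ ∃ a : Euc N → ℝ → ℝ, Measurable (Function.uncurry a) ∧
      (∀ x t, 0 ≤ a x t) ∧ (∀ x t, a x t ≤ A) ∧ ∀ x t, |g x t - a x t * w x t| ≤ η := by
  obtain ⟨c, hc, hcη⟩ := h.modulus η hη
  refine ⟨M / c, div_nonneg h.bound_nonneg hc.le,
    fun x t => if c ≤ |w x t| then g x t / w x t else 0, ?_, fun x t => ?_, fun x t => ?_,
    fun x t => ?_⟩
  · exact Measurable.ite (measurableSet_le measurable_const h.measurable_w.abs)
      (h.measurable_g.div h.measurable_w) measurable_const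
  · beta_reduce
    split_ifs
    · rcases eq_or_ne (w x t) 0 with h0 | h0
      · simp [h0]
      · rw [← mul_div_mul_right _ _ h0]
        exact div_nonneg (h.sign x t) (mul_self_nonneg (w x t))
    · exact le_rfl
  · beta_reduce
    split_ifs with hw
    · calc g x t / w x t ≤ |g x t| / |w x t| := by rw [← abs_div]; exact le_abs_self _
        _ ≤ M / c := div_le_div₀ h.bound_nonneg (h.abs_g_le x t) hc hw
    · exact div_nonneg h.bound_nonneg hc.le
  · beta_reduce
    split_ifs with hw
    · have : w x t ≠ 0 := abs_pos.1 (hc.trans_le hw)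
      rw [div_mul_cancel₀ _ this, sub_self, abs_zero]
      exact hη.le
    · rw [zero_mul, sub_zero]
      exact hcη x t (not_le.1 hw)

end DifferenceProblem

/-- Approximation of a bounded coefficient by a continuous one in a weighted `L¹` space. -/
theorem exists_continuous_coefficient {T : ℝ} {w a : Euc N → ℝ → ℝ}
    (hw : Measurable (Function.uncurry w)) (hwi : Integrable (Function.uncurry w) (QTvol N T))
    (ha : Measurable (Function.uncurry a)) {A : ℝ} (hA : 0 ≤ A) (ha0 : ∀ x t, 0 ≤ a x t)
    (haA : ∀ x t, a x t ≤ A) {ε : ℝ} (hε : 0 < ε) :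
    ∃ α : Euc N → ℝ → ℝ, Continuous (Function.uncurry α) ∧ HasCompactSupport (Function.uncurry α) ∧
      (∀ x t, 0 ≤ α x t) ∧ (∀ x t, α x t ≤ A) ∧
      ∫ p, |a p.1 p.2 - α p.1 p.2| * |w p.1 p.2| ∂(QTvol N T) ≤ ε := by
  set m : Measure (Euc N × ℝ) :=
    (QTvol N T).withDensity fun p => ENNReal.ofReal |Function.uncurry w p| with hm
  have hfin : IsFiniteMeasure m := isFiniteMeasure_withDensity_ofReal hwi.abs.2
  have hai : Integrable (Function.uncurry a) m :=
    Integrable.of_bound ha.aestronglyMeasurable A (Eventually.of_forall fun p => by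
      exact (abs_of_nonneg (ha0 p.1 p.2)).trans_le (haA p.1 p.2))
  obtain ⟨c, hcs, hac, hc, hci⟩ := hai.exists_hasCompactSupport_integral_sub_le hε
  have hαc : Continuous fun p => max 0 (min A (c p)) := by fun_prop
  refine ⟨fun x t => max 0 (min A (c (x, t))), hαc, ?_, fun x t => le_max_left _ _,
    fun x t => max_le hA (min_le_left _ _), ?_⟩
  · exact hcs.comp_left (g := fun r : ℝ => max 0 (min A r)) (by simp [hA])
  · have hle : ∀ p : Euc N × ℝ, |a p.1 p.2 - max 0 (min A (c p))| ≤ |a p.1 p.2 - c p| := fun p => by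
      have e1 : a p.1 p.2 = max 0 (min A (a p.1 p.2)) := by
        rw [min_eq_right (haA _ _), max_eq_right (ha0 _ _)]
      calc |a p.1 p.2 - max 0 (min A (c p))|
          = |max 0 (min A (a p.1 p.2)) - max 0 (min A (c p))| := by rw [← e1]
        _ ≤ |min A (a p.1 p.2) - min A (c p)| := by
          simpa using abs_max_sub_max_le_max 0 (min A (a p.1 p.2)) 0 (min A (c p))
        _ ≤ |a p.1 p.2 - c p| := by
          simpa using abs_min_sub_min_le_max A (a p.1 p.2) A (c p)
    have hdens := integral_withDensity_eq_integral_toReal_smul (μ := QTvol N T)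
      (f := fun p => ENNReal.ofReal |Function.uncurry w p|) (hw.abs.ennreal_ofReal)
      (Eventually.of_forall fun _ => ENNReal.ofReal_lt_top)
      (fun p => |a p.1 p.2 - max 0 (min A (c p))|)
    have e2 : ∫ p, |a p.1 p.2 - max 0 (min A (c p))| * |w p.1 p.2| ∂(QTvol N T) =
        ∫ p, |a p.1 p.2 - max 0 (min A (c p))| ∂m := by
      rw [hm, hdens]
      congr 1 with p
      rw [ENNReal.toReal_ofReal (abs_nonneg _), smul_eq_mul, mul_comm]
      rfl
    have i1 : Integrable (fun p : Euc N × ℝ => |a p.1 p.2 - c p|) m := (hai.sub hci).abs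
    refine e2.le.trans (le_trans (integral_mono ?_ i1 hle) hac)
    exact integrable_of_abs_le i1 (ha.sub hαc.measurable).abs fun p => by
      rw [abs_abs]; exact hle p

/-- Total error made when the mollified flux is replaced by the coefficient `α` times the mollified
density. -/
def defect (ρ : Euc N → ℝ) (w a α : Euc N → ℝ → ℝ) (c : ℝ) (x : Euc N) (s : ℝ) : ℝ :=
  |corr ρ (fun x t => a x t * w x t) x s - a x s * w x s| + c * |corr ρ w x s - w x s| +
    |a x s - α x s| * |w x s|

theorem measurable_defect {ρ : Euc N → ℝ} {w a α : Euc N → ℝ → ℝ} (hρ : Measurable ρ)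
    (hw : Measurable (Function.uncurry w)) (ha : Measurable (Function.uncurry a))
    (hα : Measurable (Function.uncurry α)) (c : ℝ) :
    Measurable (Function.uncurry (defect ρ w a α c)) := by
  have haw : Measurable (Function.uncurry fun x t => a x t * w x t) := ha.mul hw
  exact (((measurable_corr hρ haw).sub haw).abs.add
    (((measurable_corr hρ hw).sub hw).abs.const_mul c)).add ((ha.sub hα).abs.mul hw.abs)

theorem exists_uniform_time_step {α : Euc N → ℝ → ℝ} (hα : Continuous (Function.uncurry α))
    (hαs : HasCompactSupport (Function.uncurry α)) {ε : ℝ} (hε : 0 < ε) :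
    ∃ δ > 0, ∀ x s t, |s - t| < δ → |α x s - α x t| ≤ ε := by
  obtain ⟨δ, hδ, h⟩ :=
    Metric.uniformContinuous_iff.1 (hαs.uniformContinuous_of_continuous hα) ε hε
  refine ⟨δ, hδ, fun x s t hst => ?_⟩
  have := h (a := (x, s)) (b := (x, t)) (by
    rw [Prod.dist_eq, dist_self, max_eq_right dist_nonneg, Real.dist_eq]; exact hst)
  rw [Real.dist_eq] at this
  exact this.le

theorem DifferenceProblem.evolved_estimate {μ : Measure (Euc N)} {T M : ℝ} {w0 : Euc N → ℝ}
    {w g : Euc N → ℝ → ℝ} (h : DifferenceProblem μ T M w0 w g)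
    {a α : Euc N → ℝ → ℝ} {A η : ℝ} (ha : Measurable (Function.uncurry a))
    (ha0 : ∀ x t, 0 ≤ a x t) (haA : ∀ x t, a x t ≤ A)
    (hη : ∀ x t, |g x t - a x t * w x t| ≤ η)
    (hα : Continuous (Function.uncurry α)) (hαs : HasCompactSupport (Function.uncurry α))
    (hα0 : ∀ x t, 0 ≤ α x t) (hαA : ∀ x t, α x t ≤ A) {κ β σ ε δ : ℝ} (hκ : 0 < κ) (hβ : 0 < β)
    (hσ : 0 < σ) {ρ : Euc N → ℝ} (hρ : IsMollifier δ ρ)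
    {ν : Measure (Euc N)} [IsFiniteMeasure ν] [ν.IsNegInvariant]
    (hε : M * ∫ x, |Lop μ ρ x - jump ν ρ x| ≤ ε) {θ : Euc N → ℝ} (hθ : IsNice θ)
    (hθ0 : ∀ x, 0 ≤ θ x)
    (hD : Integrable (fun p : Euc N × ℝ => defect ρ w a α (A + κ) p.1 p.2 ^ 2) (QTvol N T))
    {t₁ : ℝ} (ht₁ : t₁ ∈ Ioo 0 T) :
    ∫ x, evolved μ ρ w0 g x t₁ * θ x ≤
      (1 / (2 * σ)) * (∫ p, defect ρ w a α (A + κ) p.1 p.2 ^ 2 ∂(QTvol N T)) +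
        σ / (2 * κ) * (-∫ x, θ x * jump ν θ x) + t₁ * (η + κ * M + β) * (∫ x, |jump ν θ x|) +
        t₁ * ε * ((∫ x, θ x) + t₁ * (A + κ) * ∫ x, |jump ν θ x|) := by
  obtain ⟨ν', -, -, hν'⟩ := h.levy.exists_approx
  obtain ⟨hLm, hLi, -⟩ := hν' ρ hρ.isTestFn
  have hρn := hρ.isTestFn.isNice
  have hM := h.bound_nonneg
  have hA : 0 ≤ A := (ha0 0 0).trans (haA 0 0)
  have hAκ : 0 < A + κ := by positivity
  have hη0 : 0 ≤ η := (abs_nonneg _).trans (hη 0 0)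
  have hρ1 : ∫ y, |ρ y| = 1 := by
    rw [← hρ.integral_eq_one]
    congr 1 with y
    exact abs_of_nonneg (hρ.nonneg y)
  set CG := M * ∫ y, |Lop μ ρ y| with hCGdef
  have hCG0 : 0 ≤ CG := mul_nonneg hM (integral_nonneg fun _ => abs_nonneg _)
  have hCG : ∀ x s, |corr (Lop μ ρ) g x s| ≤ CG := abs_corr_le hLi h.abs_g_le
  have hGm := measurable_corr_Lop h.levy hρ.isTestFn h.measurable_g
  have hwρ : ∀ x s, |corr ρ w x s| ≤ M := fun x s => by
    simpa [hρ1] using abs_corr_le hρn.integrable h.abs_w_le x s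
  have hGh : ∀ x s, |corr (Lop μ ρ) g x s - jump ν (fun y => corr ρ g y s) x| ≤ ε := fun x s => by
    rw [jump_corr hρn h.measurable_g h.abs_g_le,
      corr_sub_kernel hLi hρn.jump.integrable h.measurable_g h.abs_g_le]
    exact (abs_corr_le (hLi.sub hρn.jump.integrable) h.abs_g_le x s).trans hε
  obtain ⟨δα, hδα, hunif⟩ := exists_uniform_time_step hα hαs (ε := β / (2 * (M + 1))) (by positivity)
  obtain ⟨K, hK⟩ := exists_nat_gt (max (2 * (t₁ * (A + κ) * ν.real univ))
    (max (t₁ / δα) (t₁ * (2 * ((A + κ) * CG + 1)) / β)))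
  have hK1 := (le_max_left _ _).trans_lt hK
  have hK2 := ((le_max_left _ _).trans (le_max_right _ _)).trans_lt hK
  have hK3 := ((le_max_right _ _).trans (le_max_right _ _)).trans_lt hK
  have hK0 : (0 : ℝ) < K := lt_of_le_of_lt (by have := ht₁.1; positivity) hK1
  have hτ0 : 0 < t₁ / K := div_pos ht₁.1 hK0
  have hτδ : t₁ / K < δα := by
    rw [div_lt_iff₀ hK0, mul_comm, ← div_lt_iff₀ hδα]
    exact hK2
  have hτβ : (A + κ) * (CG * (t₁ / K)) ≤ β / 2 := by
    have h1 : t₁ / K * (2 * ((A + κ) * CG + 1)) ≤ β := by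
      rw [div_lt_iff₀ hβ] at hK3
      rw [div_mul_eq_mul_div, div_le_iff₀ hK0]
      linarith
    nlinarith
  have hcfl : 2 * (t₁ / K * (A + κ) * ν.real univ) ≤ 1 := by
    have e : 2 * (t₁ / K * (A + κ) * ν.real univ) = 2 * (t₁ * (A + κ) * ν.real univ) / K := by ring
    rw [e, div_le_one hK0]
    exact hK1.le
  have hsub : Ioc 0 t₁ ⊆ Ioo 0 T := fun s hs => ⟨hs.1, hs.2.trans_lt ht₁.2⟩
  have hDT : IntegrableOn (fun s => ∫ x, defect ρ w a α (A + κ) x s ^ 2) (Ioo 0 T) :=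
    Integrable.integral_prod_right (μ := (volume : Measure (Euc N))) hD
  have hw0m : Measurable fun x => corr ρ (fun x _ => w0 x) x 0 :=
    (measurable_corr hρn.measurable (f := fun x (_ : ℝ) => w0 x)
      (h.measurable_w0.comp measurable_fst)).comp (measurable_prodMk_right (y := (0 : ℝ)))
  have hw0b : ∀ x, |corr ρ (fun x _ => w0 x) x 0| ≤ M := fun x => by
    have := abs_corr_le hρn.integrable (f := fun x (_ : ℝ) => w0 x) (M := M)
      (fun x _ => h.abs_w0_le x) x 0
    rwa [hρ1, mul_one] at this
  have hw0n : ∀ x, corr ρ (fun x _ => w0 x) x 0 ≤ 0 := fun x => by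
    refine integral_nonpos_of_ae ?_
    have := (measurePreserving_add_left volume x).quasiMeasurePreserving.ae h.nonpos
    filter_upwards [this] with y hy
    exact mul_nonpos_of_nonneg_of_nonpos (hρ.nonneg y) hy
  have haw : Measurable (Function.uncurry fun x t => a x t * w x t) := ha.mul h.measurable_w
  have hawb : ∀ x t, |a x t * w x t| ≤ A * M := fun x t => by
    rw [abs_mul, abs_of_nonneg (ha0 x t)]
    exact mul_le_mul (haA x t) (h.abs_w_le x t) (abs_nonneg _) hA
  have hpt : ∀ x s, |corr ρ g x s - (α x s + κ) * corr ρ w x s| ≤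
      defect ρ w a α (A + κ) x s + (η + κ * M) := fun x s => by
    have e1 := corr_sub hρn.integrable h.measurable_g h.abs_g_le haw hawb x s
    have e2 : |corr ρ (fun x t => g x t - a x t * w x t) x s| ≤ η := by
      simpa [hρ1] using abs_corr_le hρn.integrable hη x s
    rw [e1] at e2
    have e3 : corr ρ g x s - (α x s + κ) * corr ρ w x s =
        (corr ρ g x s - corr ρ (fun x t => a x t * w x t) x s) +
        (corr ρ (fun x t => a x t * w x t) x s - a x s * w x s) -
        (α x s + κ) * (corr ρ w x s - w x s) + (a x s - α x s) * w x s - κ * w x s := by ring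
    have e4 : |(α x s + κ) * (corr ρ w x s - w x s)| ≤ (A + κ) * |corr ρ w x s - w x s| := by
      rw [abs_mul, abs_of_nonneg (by linarith [hα0 x s])]
      exact mul_le_mul_of_nonneg_right (by linarith [hαA x s]) (abs_nonneg _)
    have e5 : |κ * w x s| ≤ κ * M := by
      rw [abs_mul, abs_of_pos hκ]
      exact mul_le_mul_of_nonneg_left (h.abs_w_le x s) hκ.le
    have e6 := abs_mul (a x s - α x s) (w x s)
    rw [e3, defect]
    refine (abs_sub _ _).trans ?_
    have f1 := abs_add_le ((corr ρ g x s - corr ρ (fun x t => a x t * w x t) x s) +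
        (corr ρ (fun x t => a x t * w x t) x s - a x s * w x s) -
        (α x s + κ) * (corr ρ w x s - w x s)) ((a x s - α x s) * w x s)
    have f2 := abs_sub ((corr ρ g x s - corr ρ (fun x t => a x t * w x t) x s) +
        (corr ρ (fun x t => a x t * w x t) x s - a x s * w x s))
        ((α x s + κ) * (corr ρ w x s - w x s))
    have f3 := abs_add_le (corr ρ g x s - corr ρ (fun x t => a x t * w x t) x s)
        (corr ρ (fun x t => a x t * w x t) x s - a x s * w x s)
    linarith
  have key := duality_estimate (ν := ν) (G := corr (Lop μ ρ) g) (h := corr ρ g)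
    (D := defect ρ w a α (A + κ)) (w₀ := fun x => corr ρ (fun x _ => w0 x) x 0) (θ := θ)
    (a := fun j x => α x (t₁ - j * (t₁ / K)) + κ) (K := K) (CW := M) (b := η + κ * M + β) (σ := σ)
    ht₁.1.le (by rintro rfl; simp at hK0) hGm hCG (measurable_corr hρn.measurable h.measurable_g)
    (abs_corr_le hρn.integrable h.abs_g_le) hGh hw0m
    hw0b hw0n hθ hθ0
    (fun j => (hα.measurable.comp measurable_prodMk_right).add_const κ) hκ
    (fun j x => by linarith [hα0 x (t₁ - j * (t₁ / K))])
    (fun j x => by linarith [hαA x (t₁ - j * (t₁ / K))]) hcfl hσ (by positivity)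
    ((abs_nonneg _).trans (hGh 0 0)) (hDT.mono_set hsub)
    (ae_restrict_of_ae_restrict_of_subset hsub (Integrable.prod_left_ae hD)) ?_
  · refine key.trans ?_
    gcongr
    rw [QTvol, integral_prod_symm _ hD]
    exact setIntegral_mono_set hDT (Eventually.of_forall fun s => integral_nonneg fun x => sq_nonneg _)
      hsub.eventuallyLE
  · filter_upwards [ae_restrict_of_ae_restrict_of_subset hsub (h.ae_ae_eqn hρ.isTestFn)] with s hs
    filter_upwards [hs] with x hx j hj
    set tj := t₁ - j * (t₁ / K) with htj
    have htj1 : t₁ - ((j + 1 : ℕ) : ℝ) * (t₁ / K) = tj - t₁ / K := by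
      rw [htj]; push_cast; ring
    rw [htj1] at hj ⊢
    have hGi : ∀ r s, IntervalIntegrable (corr (Lop μ ρ) g x) volume r s := fun r s => by
      rw [intervalIntegrable_iff]
      exact Measure.integrableOn_of_bounded (M := CG) (by simp)
        (hGm.comp measurable_prodMk_left).aestronglyMeasurable
        (Eventually.of_forall fun s => hCG x s)
    have hWd : |evolved μ ρ w0 g x s - evolved μ ρ w0 g x (tj - t₁ / K)| ≤ CG * (t₁ / K) := by
      have e : evolved μ ρ w0 g x s - evolved μ ρ w0 g x (tj - t₁ / K) =
          ∫ r in (tj - t₁ / K)..s, corr (Lop μ ρ) g x r := by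
        rw [evolved, evolved, add_sub_add_left_eq_sub,
          intervalIntegral.integral_interval_sub_left (hGi _ _) (hGi _ _)]
      rw [e]
      refine (intervalIntegral.norm_integral_le_of_norm_le_const (C := CG)
        (f := corr (Lop μ ρ) g x) fun r _ => hCG x r).trans ?_
      gcongr
      rw [abs_of_nonneg (by linarith [hj.1])]
      linarith [hj.2]
    have hαd : |α x s - α x tj| ≤ β / (2 * (M + 1)) := hunif x s tj (by
      rw [abs_lt]; constructor <;> linarith [hj.1, hj.2])
    have hWM : |evolved μ ρ w0 g x s| ≤ M := hx ▸ hwρ x s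
    have h1 := hpt x s
    rw [hx] at h1
    have h2 : |(α x s - α x tj) * evolved μ ρ w0 g x s| ≤ β / 2 := by
      rw [abs_mul]
      calc |α x s - α x tj| * |evolved μ ρ w0 g x s| ≤ β / (2 * (M + 1)) * (M + 1) := by
            gcongr; linarith
        _ = β / 2 := by field_simp
    have h3 : |(α x tj + κ) * (evolved μ ρ w0 g x s - evolved μ ρ w0 g x (tj - t₁ / K))| ≤ β / 2 := by
      rw [abs_mul, abs_of_nonneg (by linarith [hα0 x tj])]
      refine le_trans ?_ hτβ
      gcongr
      exact hαA x tj
    have e : corr ρ g x s - (α x tj + κ) * evolved μ ρ w0 g x (tj - t₁ / K) =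
        (corr ρ g x s - (α x s + κ) * evolved μ ρ w0 g x s) +
        (α x s - α x tj) * evolved μ ρ w0 g x s +
        (α x tj + κ) * (evolved μ ρ w0 g x s - evolved μ ρ w0 g x (tj - t₁ / K)) := by ring
    change |corr ρ g x s - (α x tj + κ) * evolved μ ρ w0 g x (tj - t₁ / K)| ≤ _
    rw [e]
    have f1 := abs_add_le ((corr ρ g x s - (α x s + κ) * evolved μ ρ w0 g x s) +
        (α x s - α x tj) * evolved μ ρ w0 g x s)
        ((α x tj + κ) * (evolved μ ρ w0 g x s - evolved μ ρ w0 g x (tj - t₁ / K)))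
    have f2 := abs_add_le (corr ρ g x s - (α x s + κ) * evolved μ ρ w0 g x s)
        ((α x s - α x tj) * evolved μ ρ w0 g x s)
    linarith

theorem IsMollifier.mono {δ δ' : ℝ} {ρ : Euc N → ℝ} (h : IsMollifier δ ρ) (hδ : δ ≤ δ') :
    IsMollifier δ' ρ :=
  ⟨h.isTestFn, h.nonneg, h.integral_eq_one, fun y hy => h.eq_zero y (hδ.trans hy)⟩

theorem IsMollifier.abs_corr_le {δ M : ℝ} {ρ : Euc N → ℝ} {f : Euc N → ℝ → ℝ}
    (h : IsMollifier δ ρ) (hM : ∀ x t, |f x t| ≤ M) (x : Euc N) (t : ℝ) : |corr ρ f x t| ≤ M := by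
  have h1 := _root_.abs_corr_le h.isTestFn.isNice.integrable hM x t
  have h2 : ∫ y, |ρ y| = 1 := by
    rw [← h.integral_eq_one]
    congr 1 with y
    exact abs_of_nonneg (h.nonneg y)
  rwa [h2, mul_one] at h1

theorem integral_defect_sq_le {T M A c γ δ : ℝ} {ρ : Euc N → ℝ} {w a α : Euc N → ℝ → ℝ}
    (hρ : IsMollifier δ ρ) (hw : Measurable (Function.uncurry w)) (hwM : ∀ x t, |w x t| ≤ M)
    (hwi : Integrable (Function.uncurry w) (QTvol N T))
    (ha : Measurable (Function.uncurry a)) (hα : Measurable (Function.uncurry α))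
    (ha0 : ∀ x t, 0 ≤ a x t) (haA : ∀ x t, a x t ≤ A) (hα0 : ∀ x t, 0 ≤ α x t)
    (hαA : ∀ x t, α x t ≤ A) (hc : 0 ≤ c)
    (hi₁ : Integrable (fun p : Euc N × ℝ =>
      |corr ρ (fun x t => a x t * w x t) p.1 p.2 - a p.1 p.2 * w p.1 p.2|) (QTvol N T))
    (h₁ : ∫ p, |corr ρ (fun x t => a x t * w x t) p.1 p.2 - a p.1 p.2 * w p.1 p.2| ∂(QTvol N T) ≤ γ)
    (hi₂ : Integrable (fun p : Euc N × ℝ => |corr ρ w p.1 p.2 - w p.1 p.2|) (QTvol N T))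
    (h₂ : c * ∫ p, |corr ρ w p.1 p.2 - w p.1 p.2| ∂(QTvol N T) ≤ γ)
    (h₃ : ∫ p, |a p.1 p.2 - α p.1 p.2| * |w p.1 p.2| ∂(QTvol N T) ≤ γ) :
    Integrable (fun p : Euc N × ℝ => defect ρ w a α c p.1 p.2 ^ 2) (QTvol N T) ∧
      ∫ p, defect ρ w a α c p.1 p.2 ^ 2 ∂(QTvol N T) ≤
        (2 * (A * M) + c * (2 * M) + A * M) * (3 * γ) := by
  have hA : 0 ≤ A := (ha0 0 0).trans (haA 0 0)
  have haα : ∀ x t, |a x t - α x t| ≤ A := fun x t => by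
    rw [abs_le]; constructor <;> linarith [ha0 x t, haA x t, hα0 x t, hαA x t]
  have hi₃ : Integrable (fun p : Euc N × ℝ => |a p.1 p.2 - α p.1 p.2| * |w p.1 p.2|) (QTvol N T) :=
    integrable_of_abs_le (hwi.abs.const_mul A) ((ha.sub hα).abs.mul hw.abs) fun p => by
      rw [abs_mul, abs_abs, abs_abs]
      exact mul_le_mul_of_nonneg_right (haα _ _) (abs_nonneg _)
  have i₁₂ : Integrable (fun p : Euc N × ℝ =>
      |corr ρ (fun x t => a x t * w x t) p.1 p.2 - a p.1 p.2 * w p.1 p.2| +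
        c * |corr ρ w p.1 p.2 - w p.1 p.2|) (QTvol N T) := hi₁.add (hi₂.const_mul c)
  have hDi : Integrable (fun p : Euc N × ℝ => defect ρ w a α c p.1 p.2) (QTvol N T) := i₁₂.add hi₃
  have hDint : ∫ p, defect ρ w a α c p.1 p.2 ∂(QTvol N T) ≤ 3 * γ := by
    simp only [defect]
    rw [integral_add i₁₂ hi₃, integral_add hi₁ (hi₂.const_mul c), integral_const_mul]
    linarith
  have hawb : ∀ x t, |a x t * w x t| ≤ A * M := fun x t => by
    rw [abs_mul, abs_of_nonneg (ha0 x t)]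
    exact mul_le_mul (haA x t) (hwM x t) (abs_nonneg _) hA
  have hD0 : ∀ x t, 0 ≤ defect ρ w a α c x t := fun x t => by unfold defect; positivity
  have hDB : ∀ x t, defect ρ w a α c x t ≤ 2 * (A * M) + c * (2 * M) + A * M := fun x t => by
    have e1 := abs_sub (corr ρ (fun x t => a x t * w x t) x t) (a x t * w x t)
    have e2 := hρ.abs_corr_le hawb x t
    have e3 := hawb x t
    have e4 := abs_sub (corr ρ w x t) (w x t)
    have e5 := hρ.abs_corr_le hwM x t
    have e6 : c * |corr ρ w x t - w x t| ≤ c * (2 * M) := by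
      refine mul_le_mul_of_nonneg_left ?_ hc
      linarith [hwM x t]
    have e7 : |a x t - α x t| * |w x t| ≤ A * M :=
      mul_le_mul (haα x t) (hwM x t) (abs_nonneg _) hA
    unfold defect
    linarith
  have hle : ∀ p : Euc N × ℝ, defect ρ w a α c p.1 p.2 ^ 2 ≤
      (2 * (A * M) + c * (2 * M) + A * M) * defect ρ w a α c p.1 p.2 := fun p => by
    rw [pow_two]
    exact mul_le_mul_of_nonneg_right (hDB _ _) (hD0 _ _)
  have hDm := measurable_defect hρ.isTestFn.isNice.measurable hw ha hα c
  have hsq : Integrable (fun p : Euc N × ℝ => defect ρ w a α c p.1 p.2 ^ 2) (QTvol N T) :=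
    integrable_of_abs_le (hDi.const_mul _) (hDm.pow_const 2) fun p => by
      rw [abs_of_nonneg (sq_nonneg _)]; exact hle p
  refine ⟨hsq, (integral_mono hsq (hDi.const_mul _) hle).trans ?_⟩
  rw [integral_const_mul]
  exact mul_le_mul_of_nonneg_left hDint ((hD0 0 0).trans (hDB 0 0))

theorem exists_pos_mul_eq {c ε : ℝ} (hc : 0 < c) (hε : 0 < ε) : ∃ x, 0 < x ∧ c * x = ε :=
  ⟨ε / c, div_pos hε hc, mul_div_cancel₀ _ hc.ne'⟩

namespace DifferenceProblem

variable {μ : Measure (Euc N)} {T M : ℝ} {w0 : Euc N → ℝ} {w g : Euc N → ℝ → ℝ}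

theorem exists_integral_evolved_le (h : DifferenceProblem μ T M w0 w g) {θ : Euc N → ℝ}
    (hθ : IsTestFn θ) (hθ0 : ∀ x, 0 ≤ θ x) {ε : ℝ} (hε : 0 < ε) :
    ∃ δ > 0, ∀ ρ : Euc N → ℝ, IsMollifier δ ρ → ∀ t ∈ Ioo 0 T,
      ∫ x, evolved μ ρ w0 g x t * θ x ≤ ε := by
  obtain ⟨ν, hνf, hνn, hν⟩ := h.levy.exists_approx
  obtain ⟨S, hS0, hS⟩ := hθ.exists_bound
  obtain ⟨-, hLi, hLt⟩ := hν θ hθ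
  have hT := h.pos
  have hM := h.bound_nonneg
  obtain ⟨C, hC⟩ : ∃ C, C = (∫ x, |Lop μ θ x|) + 1 := ⟨_, rfl⟩
  have hC0 : 0 < C :=
    hC ▸ add_pos_of_nonneg_of_pos (integral_nonneg fun _ => abs_nonneg _) one_pos
  have hI : 0 ≤ ∫ x, θ x := integral_nonneg hθ0
  obtain ⟨β, hβ0, hβ⟩ := exists_pos_mul_eq (c := 8 * T * C) (by positivity) hε
  obtain ⟨κ, hκ0, hκ⟩ := exists_pos_mul_eq (c := M + 1) (by positivity) hβ0
  have hκM : κ * M ≤ β := by linarith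
  obtain ⟨σ, hσ0, hσ⟩ := exists_pos_mul_eq (c := 4 * (S + 1) * C) (by positivity)
    (mul_pos hκ0 hε)
  obtain ⟨A, hA, a, ham, ha0, haA, hag⟩ := h.exists_coefficient hβ0
  obtain ⟨B, hB⟩ : ∃ B, B = 2 * (A * M) + (A + κ) * (2 * M) + A * M := ⟨_, rfl⟩
  have hB0 : 0 ≤ B := by rw [hB]; positivity
  obtain ⟨γ, hγ0, hγ⟩ := exists_pos_mul_eq (c := 12 * (B + 1)) (by positivity)
    (mul_pos hσ0 hε)
  obtain ⟨α, hαc, hαs, hα0, hαA, hαi⟩ :=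
    exists_continuous_coefficient h.measurable_w h.integrable ham hA ha0 haA hγ0
  have haw : Measurable (Function.uncurry fun x t => a x t * w x t) := ham.mul h.measurable_w
  have hawb : ∀ x t, |a x t * w x t| ≤ A * M := fun x t => by
    rw [abs_mul, abs_of_nonneg (ha0 x t)]
    exact mul_le_mul (haA x t) (h.abs_w_le x t) (abs_nonneg _) hA
  have hawi : Integrable (Function.uncurry fun x t => a x t * w x t) (QTvol N T) :=
    integrable_of_abs_le (h.integrable.abs.const_mul A) haw fun p => by
      change |a p.1 p.2 * w p.1 p.2| ≤ A * |w p.1 p.2|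
      rw [abs_mul, abs_of_nonneg (ha0 _ _)]
      exact mul_le_mul_of_nonneg_right (haA _ _) (abs_nonneg _)
  obtain ⟨δ₁, hδ₁, hm₁⟩ := exists_integral_corr_sub_le haw hawb hawi hγ0
  obtain ⟨δ₂, hδ₂, hm₂⟩ := exists_integral_corr_sub_le h.measurable_w h.abs_w_le h.integrable
    (ε := γ / (A + κ)) (by positivity)
  refine ⟨min δ₁ δ₂, lt_min hδ₁ hδ₂, fun ρ hρ t ht => ?_⟩
  obtain ⟨hi₁, h₁⟩ := hm₁ ρ (hρ.mono (min_le_left _ _))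
  obtain ⟨hi₂, h₂⟩ := hm₂ ρ (hρ.mono (min_le_right _ _))
  obtain ⟨-, hLρ, hLtρ⟩ := hν ρ hρ.isTestFn
  have h₂' : (A + κ) * ∫ p, |corr ρ w p.1 p.2 - w p.1 p.2| ∂(QTvol N T) ≤ γ := by
    rw [le_div_iff₀ (by positivity)] at h₂
    linarith
  obtain ⟨hDi, hD⟩ := integral_defect_sq_le hρ h.measurable_w h.abs_w_le h.integrable ham
    hαc.measurable ha0 haA hα0 hαA (add_nonneg hA hκ0.le) hi₁ h₁ hi₂ h₂' hαi
  have hden : 0 < (∫ x, θ x) + T * (A + κ) * C := by positivity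
  obtain ⟨ζ, hζ0, hζ⟩ := exists_pos_mul_eq (c := 8 * T * ((∫ x, θ x) + T * (A + κ) * C))
    (by positivity) hε
  obtain ⟨n, hn₁, hn₂⟩ := ((hLtρ.eventually (gt_mem_nhds (show 0 < ζ / (M + 1) by positivity))).and
    (hLt.eventually (gt_mem_nhds one_pos))).exists
  have := hνf n
  have := hνn n
  have hnM : M * ∫ x, |Lop μ ρ x - jump (ν n) ρ x| ≤ ζ := by
    have : (M + 1) * ∫ x, |Lop μ ρ x - jump (ν n) ρ x| ≤ ζ := by
      rw [lt_div_iff₀ (by positivity)] at hn₁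
      linarith
    have h0 : 0 ≤ ∫ x, |Lop μ ρ x - jump (ν n) ρ x| := integral_nonneg fun _ => abs_nonneg _
    linarith
  have hθn := hθ.isNice
  have hJi := (hθn.jump (ν := ν n)).integrable
  have hJ : ∫ x, |jump (ν n) θ x| ≤ C := by
    have i1 : Integrable fun x => |Lop μ θ x - jump (ν n) θ x| := (hLi.sub hJi).abs
    have : ∫ x, |jump (ν n) θ x| ≤ ∫ x, (|Lop μ θ x| + |Lop μ θ x - jump (ν n) θ x|) := by
      refine integral_mono hJi.abs (hLi.abs.add i1) fun x => ?_
      have := abs_sub (Lop μ θ x) (Lop μ θ x - jump (ν n) θ x)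
      rwa [sub_sub_cancel] at this
    rw [integral_add hLi.abs i1] at this
    linarith
  have hE : -∫ x, θ x * jump (ν n) θ x ≤ S * C := by
    rw [← integral_neg]
    refine le_trans ?_ (mul_le_mul_of_nonneg_left hJ hS0)
    rw [← integral_const_mul]
    refine integral_mono (hJi.bdd_mul hθn.measurable.aestronglyMeasurable
      (Eventually.of_forall hS)).neg (hJi.abs.const_mul S) fun x => ?_
    refine (neg_le_abs _).trans ?_
    rw [abs_mul]
    exact mul_le_mul_of_nonneg_right (hS x) (abs_nonneg _)
  have key := h.evolved_estimate ham ha0 haA hag hαc hαs hα0 hαA hκ0 hβ0 hσ0 hρ hnM hθn hθ0 hDi ht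
  refine key.trans ?_
  have hJ0 : 0 ≤ ∫ x, |jump (ν n) θ x| := integral_nonneg fun _ => abs_nonneg _
  have b₁ : (1 / (2 * σ)) * (∫ p, defect ρ w a α (A + κ) p.1 p.2 ^ 2 ∂(QTvol N T)) ≤ ε / 8 := by
    calc (1 / (2 * σ)) * (∫ p, defect ρ w a α (A + κ) p.1 p.2 ^ 2 ∂(QTvol N T))
        ≤ (1 / (2 * σ)) * ((B + 1) * (3 * γ)) := by
          refine mul_le_mul_of_nonneg_left (hD.trans ?_) (by positivity)
          refine mul_le_mul_of_nonneg_right ?_ (by positivity)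
          linarith
      _ = ε / 8 := by field_simp; linarith
  have b₂ : σ / (2 * κ) * (-∫ x, θ x * jump (ν n) θ x) ≤ ε / 8 := by
    calc σ / (2 * κ) * (-∫ x, θ x * jump (ν n) θ x) ≤ σ / (2 * κ) * ((S + 1) * C) := by
          refine mul_le_mul_of_nonneg_left (hE.trans ?_) (by positivity)
          nlinarith
      _ = ε / 8 := by field_simp; linarith
  have b₃ : t * (β + κ * M + β) * (∫ x, |jump (ν n) θ x|) ≤ 3 * (ε / 8) := by
    calc t * (β + κ * M + β) * (∫ x, |jump (ν n) θ x|) ≤ T * (3 * β) * C := by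
          have := ht.1
          gcongr
          · exact ht.2.le
          · linarith
      _ = 3 * (ε / 8) := by linarith
  have b₄ : t * ζ * ((∫ x, θ x) + t * (A + κ) * ∫ x, |jump (ν n) θ x|) ≤ ε / 8 := by
    calc t * ζ * ((∫ x, θ x) + t * (A + κ) * ∫ x, |jump (ν n) θ x|)
        ≤ T * ζ * ((∫ x, θ x) + T * (A + κ) * C) := by
          have := ht.1
          have := ht.2.le
          gcongr
      _ = ε / 8 := by linarith
  linarith

theorem integral_mul_test_nonpos (h : DifferenceProblem μ T M w0 w g) {θ : Euc N → ℝ}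
    (hθ : IsTestFn θ) (hθ0 : ∀ x, 0 ≤ θ x) :
    ∀ᵐ t ∂(volume.restrict (Ioo 0 T)), ∫ x, w x t * θ x ≤ 0 := by
  have hT := h.pos
  obtain ⟨S, hS0, hS⟩ := hθ.exists_bound
  have hθn := hθ.isNice
  have hwi : Integrable (fun p : Euc N × ℝ => w p.1 p.2 * θ p.1) (QTvol N T) :=
    h.integrable.mul_bdd (hθn.measurable.comp measurable_fst).aestronglyMeasurable
      (Eventually.of_forall fun p => hS p.1)
  have hmi : IntegrableOn (fun t => ∫ x, w x t * θ x) (Ioo 0 T) :=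
    Integrable.integral_prod_right (μ := (volume : Measure (Euc N))) hwi
  have hpi : IntegrableOn (fun t => max (∫ x, w x t * θ x) 0) (Ioo 0 T) := hmi.pos_part
  have hbound : ∀ ε > 0, ∫ t in Ioo 0 T, max (∫ x, w x t * θ x) 0 ≤ ε * (T + S) := by
    intro ε hε
    obtain ⟨δ₁, hδ₁, h₁⟩ := h.exists_integral_evolved_le hθ hθ0 hε
    obtain ⟨δ₂, hδ₂, h₂⟩ := exists_integral_corr_sub_le h.measurable_w h.abs_w_le h.integrable hε
    obtain ⟨ρ, hρ⟩ := exists_isMollifier (N := N) (lt_min hδ₁ hδ₂)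
    obtain ⟨hi, hle⟩ := h₂ ρ (hρ.mono (min_le_right _ _))
    have hri : IntegrableOn (fun t => ∫ x, |corr ρ w x t - w x t|) (Ioo 0 T) :=
      Integrable.integral_prod_right (μ := (volume : Measure (Euc N))) hi
    have hci : IntegrableOn (fun _ : ℝ => ε) (Ioo 0 T) := integrableOn_const (by simp)
    calc ∫ t in Ioo 0 T, max (∫ x, w x t * θ x) 0
        ≤ ∫ t in Ioo 0 T, (ε + S * ∫ x, |corr ρ w x t - w x t|) := by
          refine integral_mono_ae hpi (hci.add (hri.const_mul S)) ?_
          filter_upwards [h.ae_ae_eqn hρ.isTestFn, ae_restrict_mem measurableSet_Ioo,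
            Integrable.prod_left_ae hi] with t ht hmem hit
          have hit' : Integrable fun x => |corr ρ w x t - w x t| := hit
          have hr0 : 0 ≤ ∫ x, |corr ρ w x t - w x t| := integral_nonneg fun _ => abs_nonneg _
          refine max_le ?_ (by positivity)
          have e1 : ∫ x, corr ρ w x t * θ x ≤ ε := by
            refine le_of_eq_of_le (integral_congr_ae ?_)
              (h₁ ρ (hρ.mono (min_le_left _ _)) t hmem)
            filter_upwards [ht] with x hx
            rw [hx]
          have i1 : Integrable fun x => corr ρ w x t * θ x :=
            hθn.integrable.bdd_mul
              ((measurable_corr hρ.isTestFn.isNice.measurable h.measurable_w).comp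
                measurable_prodMk_right).aestronglyMeasurable
              (Eventually.of_forall fun x => hρ.abs_corr_le h.abs_w_le x t)
          have i2 : Integrable fun x => w x t * θ x :=
            hθn.integrable.bdd_mul
              (h.measurable_w.comp measurable_prodMk_right).aestronglyMeasurable
              (Eventually.of_forall fun x => h.abs_w_le x t)
          have e2 : ∫ x, w x t * θ x ≤
              ∫ x, (corr ρ w x t * θ x + S * |corr ρ w x t - w x t|) := by
            refine integral_mono i2 (i1.add (hit'.const_mul S)) fun x => ?_
            have f1 : |(corr ρ w x t - w x t) * θ x| ≤ S * |corr ρ w x t - w x t| := by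
              rw [abs_mul, mul_comm]
              exact mul_le_mul_of_nonneg_right (hS x) (abs_nonneg _)
            have f2 := neg_le_of_abs_le f1
            simp only
            linarith
          rw [integral_add i1 (hit'.const_mul S), integral_const_mul] at e2
          linarith
      _ = ε * T + S * ∫ p, |corr ρ w p.1 p.2 - w p.1 p.2| ∂(QTvol N T) := by
          rw [integral_add hci (hri.const_mul S), integral_const_mul, QTvol, integral_prod_symm _ hi]
          simp [hT.le, mul_comm]
      _ ≤ ε * (T + S) := by nlinarith
  have h0 : ∫ t in Ioo 0 T, max (∫ x, w x t * θ x) 0 ≤ 0 := by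
    refine le_of_forall_pos_le_add fun ε hε => ?_
    have := hbound (ε / (T + S)) (by positivity)
    rwa [div_mul_cancel₀ _ (by positivity), ← zero_add ε] at this
  have h1 := (integral_eq_zero_iff_of_nonneg (fun t => le_max_right _ _) hpi).1
    (le_antisymm h0 (integral_nonneg fun t => le_max_right _ _))
  filter_upwards [h1] with t ht
  exact (le_max_left _ _).trans ht.le

theorem ae_nonpos (h : DifferenceProblem μ T M w0 w g) : ∀ᵐ p ∂(QTvol N T), w p.1 p.2 ≤ 0 := by
  have hcorr : ∀ (δ : ℝ) (ρ : Euc N → ℝ), IsMollifier δ ρ →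
      ∀ᵐ p ∂(QTvol N T), corr ρ w p.1 p.2 ≤ 0 := by
    intro δ ρ hρ
    have hm := measurable_corr hρ.isTestFn.isNice.measurable h.measurable_w
    have hset : MeasurableSet {p : Euc N × ℝ | corr ρ w p.1 p.2 ≤ 0} :=
      measurableSet_le hm measurable_const
    refine (Measure.ae_prod_iff_ae_ae hset).2 (Eventually.of_forall fun x => ?_)
    have hθ : IsTestFn (fun y => ρ (y - x)) :=
      ⟨hρ.isTestFn.1.comp (contDiff_id.sub contDiff_const),
        hρ.isTestFn.2.comp_homeomorph (Homeomorph.subRight x)⟩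
    filter_upwards [h.integral_mul_test_nonpos hθ fun y => hρ.nonneg _] with t ht
    rw [← integral_add_left_eq_self _ x] at ht
    simpa [corr, mul_comm] using ht
  have hpi : Integrable (fun p : Euc N × ℝ => max (w p.1 p.2) 0) (QTvol N T) :=
    h.integrable.pos_part
  have h0 : ∫ p, max (w p.1 p.2) 0 ∂(QTvol N T) ≤ 0 := by
    refine le_of_forall_pos_le_add fun ε hε => ?_
    obtain ⟨δ, hδ, hle⟩ := exists_integral_corr_sub_le h.measurable_w h.abs_w_le h.integrable hε
    obtain ⟨ρ, hρ⟩ := exists_isMollifier (N := N) hδ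
    obtain ⟨hi, hle⟩ := hle ρ hρ
    rw [zero_add]
    refine le_trans (integral_mono_ae hpi hi ?_) hle
    filter_upwards [hcorr δ ρ hρ] with p hp
    refine max_le ?_ (abs_nonneg _)
    linarith [neg_abs_le (corr ρ w p.1 p.2 - w p.1 p.2)]
  have h1 := (integral_eq_zero_iff_of_nonneg (fun p => le_max_right _ _) hpi).1
    (le_antisymm h0 (integral_nonneg fun p => le_max_right _ _))
  filter_upwards [h1] with p hp
  exact (le_max_left _ _).trans hp.le

end DifferenceProblem

theorem intervalIntegrable_corr {k : Euc N → ℝ} {f : Euc N → ℝ → ℝ} {M : ℝ} (hk : Measurable k)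
    (hki : Integrable k) (hf : Measurable (Function.uncurry f)) (hM : ∀ x t, |f x t| ≤ M)
    (x : Euc N) (a b : ℝ) : IntervalIntegrable (corr k f x) volume a b :=
  (intervalIntegrable_const (c := M * ∫ y, |k y|)).mono_fun'
    ((measurable_corr hk hf).comp measurable_prodMk_left).aestronglyMeasurable
    (Eventually.of_forall fun s => abs_corr_le hki hM x s)

/-- The difference of two bounded measurable solutions with ordered data solves a
difference problem. -/
theorem IsDistSolOp.exists_differenceProblem {μ : Measure (Euc N)} (hμ : IsLevyMeasure μ) {T : ℝ}
    (hT : 0 < T) {φ : ℝ → ℝ} (hφc : Continuous φ) (hφm : Monotone φ) {u0 v0 : Euc N → ℝ}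
    {u v : Euc N → ℝ → ℝ} {C : ℝ} (hu0m : Measurable u0) (hv0m : Measurable v0)
    (hum : Measurable (Function.uncurry u)) (hvm : Measurable (Function.uncurry v))
    (hu0 : ∀ x, |u0 x| ≤ C) (hv0 : ∀ x, |v0 x| ≤ C) (hu : ∀ x t, |u x t| ≤ C)
    (hv : ∀ x t, |v x t| ≤ C) (hui : Integrable (Function.uncurry u) (QTvol N T))
    (hvi : Integrable (Function.uncurry v) (QTvol N T)) (hus : IsDistSolOp T (Lop μ) φ u0 u)
    (hvs : IsDistSolOp T (Lop μ) φ v0 v) (hle : ∀ᵐ x, u0 x ≤ v0 x) :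
    ∃ M, DifferenceProblem μ T M (fun x => u0 x - v0 x) (fun x t => u x t - v x t)
      (fun x t => φ (u x t) - φ (v x t)) := by
  set C' := max |φ C| |φ (-C)| with hC'
  have hφb : ∀ r, |r| ≤ C → |φ r| ≤ C' := fun r hr => by
    obtain ⟨h1, h2⟩ := abs_le.1 hr
    have h3 := hφm h1
    have h4 := hφm h2
    refine abs_le.2 ⟨?_, ?_⟩
    · linarith [neg_abs_le (φ (-C)), le_max_right |φ C| |φ (-C)|]
    · linarith [le_abs_self (φ C), le_max_left |φ C| |φ (-C)|]
  have hsub : ∀ {r s K L : ℝ}, |r| ≤ K → |s| ≤ K → 2 * K ≤ L → |r - s| ≤ L := by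
    intro r s K L hr hs hK
    linarith [abs_sub r s]
  have hφu : Measurable (Function.uncurry fun x t => φ (u x t)) := hφc.measurable.comp hum
  have hφv : Measurable (Function.uncurry fun x t => φ (v x t)) := hφc.measurable.comp hvm
  refine ⟨max (2 * C) (2 * C'),
    { levy := hμ
      pos := hT
      measurable_w0 := hu0m.sub hv0m
      measurable_w := hum.sub hvm
      measurable_g := hφu.sub hφv
      abs_w0_le := fun x => hsub (hu0 x) (hv0 x) (le_max_left _ _)
      abs_w_le := fun x t => hsub (hu x t) (hv x t) (le_max_left _ _)
      abs_g_le := fun x t => hsub (hφb _ (hu x t)) (hφb _ (hv x t)) (le_max_right _ _)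
      integrable := hui.sub hvi
      nonpos := hle.mono fun x hx => sub_nonpos.2 hx
      sign := fun x t => ?_
      modulus := fun η hη => ?_
      eqn := fun ρ hρ x => ?_ }⟩
  · rcases le_total (u x t) (v x t) with h | h
    · exact mul_nonneg_of_nonpos_of_nonpos (sub_nonpos.2 (hφm h)) (sub_nonpos.2 h)
    · exact mul_nonneg (sub_nonneg.2 (hφm h)) (sub_nonneg.2 h)
  · obtain ⟨c, hc, hcη⟩ := Metric.uniformContinuousOn_iff_le.1
      ((isCompact_Icc (a := -C) (b := C)).uniformContinuousOn_of_continuous hφc.continuousOn) η hη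
    refine ⟨c, hc, fun x t hxt => ?_⟩
    exact hcη _ (abs_le.1 (hu x t)) _ (abs_le.1 (hv x t)) hxt.le
  · obtain ⟨ν, -, -, hν⟩ := hμ.exists_approx
    obtain ⟨hLm, hLi, -⟩ := hν ρ hρ
    have hρi := hρ.isNice.integrable
    filter_upwards [corr_eq hμ hT hφc hum hu (fun x t => hφb _ (hu x t)) hus hρ x,
      corr_eq hμ hT hφc hvm hv (fun x t => hφb _ (hv x t)) hvs hρ x] with t h1 h2
    have e0 := corr_sub (f := fun x (_ : ℝ) => u0 x) (g := fun x (_ : ℝ) => v0 x) hρi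
      (hu0m.comp measurable_fst) (fun x _ => hu0 x) (hv0m.comp measurable_fst)
      (fun x _ => hv0 x) x 0
    have e1 : ∫ s in (0 : ℝ)..t, corr (Lop μ ρ) (fun x t => φ (u x t) - φ (v x t)) x s =
        (∫ s in (0 : ℝ)..t, corr (Lop μ ρ) (fun x t => φ (u x t)) x s) -
          ∫ s in (0 : ℝ)..t, corr (Lop μ ρ) (fun x t => φ (v x t)) x s := by
      rw [← intervalIntegral.integral_sub
        (intervalIntegrable_corr hLm hLi hφu (fun x t => hφb _ (hu x t)) x 0 t)
        (intervalIntegrable_corr hLm hLi hφv (fun x t => hφb _ (hv x t)) x 0 t)]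
      congr 1 with s
      exact corr_sub hLi hφu (fun x t => hφb _ (hu x t)) hφv (fun x t => hφb _ (hv x t)) x s
    rw [corr_sub hρi hum hu hvm hv, evolved, e0, e1, h1, h2]
    simp only [corr]
    ring

end

/-- Comparison principle (Theorem 2.6 (b)).
If `u₀ ≤ û₀` a.e. in `ℝ^N`, then `u ≤ û` a.e. in `Q_T`. -/
theorem comparison_principle
    (N : ℕ) (hN : 0 < N) (T : ℝ) (hT : 0 < T)
    (φ : ℝ → ℝ) (hφc : Continuous φ) (hφm : Monotone φ)
    (μ : Measure (Euc N)) (hμ : IsLevyMeasure μ)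
    (u0 v0 : Euc N → ℝ)
    (hu0inf : MemLinfRn u0) (hu01 : Integrable u0 (volume : Measure (Euc N)))
    (hv0inf : MemLinfRn v0) (hv01 : Integrable v0 (volume : Measure (Euc N)))
    (u v : Euc N → ℝ → ℝ)
    (huinf : MemLinfQT T u) (hu1 : MemL1QT T u) (huC : MemCL1loc T u)
    (hvinf : MemLinfQT T v) (hv1 : MemL1QT T v) (hvC : MemCL1loc T v)
    (husol : IsDistSolOp T (Lop μ) φ u0 u)
    (hvsol : IsDistSolOp T (Lop μ) φ v0 v)
    (hle : ∀ᵐ x : Euc N ∂volume, u0 x ≤ v0 x) :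
    ∀ᵐ p ∂(QTvol N T), u p.1 p.2 ≤ v p.1 p.2 := by
  obtain ⟨hum, Cu, hCu⟩ := huinf
  obtain ⟨hvm, Cv, hCv⟩ := hvinf
  obtain ⟨hu0m, Cu0, hCu0⟩ := hu0inf
  obtain ⟨hv0m, Cv0, hCv0⟩ := hv0inf
  obtain ⟨u', hu'm, hu', huu'⟩ := exists_measurable_bounded_rep hum hCu
  obtain ⟨v', hv'm, hv', hvv'⟩ := exists_measurable_bounded_rep hvm hCv
  obtain ⟨u0', hu0'm, hu0', huu0'⟩ := exists_measurable_bounded_rep hu0m hCu0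
  obtain ⟨v0', hv0'm, hv0', hvv0'⟩ := exists_measurable_bounded_rep hv0m hCv0
  obtain ⟨M, hM⟩ := IsDistSolOp.exists_differenceProblem hμ hT hφc hφm
    (u := fun x t => u' (x, t)) (v := fun x t => v' (x, t)) (C := |Cu| + |Cv| + |Cu0| + |Cv0|)
    hu0'm hv0'm hu'm hv'm
    (fun x => (hu0' x).trans (by linarith [abs_nonneg Cu, abs_nonneg Cv, abs_nonneg Cv0]))
    (fun x => (hv0' x).trans (by linarith [abs_nonneg Cu, abs_nonneg Cv, abs_nonneg Cu0]))
    (fun x t => (hu' _).trans (by linarith [abs_nonneg Cv, abs_nonneg Cu0, abs_nonneg Cv0]))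
    (fun x t => (hv' _).trans (by linarith [abs_nonneg Cu, abs_nonneg Cu0, abs_nonneg Cv0]))
    (hu1.congr huu') (hv1.congr hvv') (husol.congr huu0' huu') (hvsol.congr hvv0' hvv')
    (by filter_upwards [hle, huu0', hvv0'] with x hx h1 h2; rwa [← h1, ← h2])
  filter_upwards [hM.ae_nonpos, huu', hvv'] with p hp h1 h2
  rw [h1, h2]
  exact sub_nonpos.1 hp
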